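/- There exist absolute constants C₀, C_d, C_T > 0 such that the following holds for all integers m ≥ n ≥ 1, r ≥ 1, all μ ≥ 1, and every μ-incoherent rank-r matrix M ∈ ℝ^{m×n}. Set α = m/n, κ = Σmax/Σmin and δ = Σmin/(C_d·r^{3/2}·κ). Let Ω be drawn uniformly at random from the family of all subsets of [m]×[n] of a fixed cardinality S with S ≥ C₀·α·n·r·κ²·max{μ·log n, √α·μ²·r⁶·κ⁴}, and put p = S/(mn). Then with probability at least 1 − 1/n⁴ the following event holds: for every pair (X,Y) ∈ K₁ ∩ K₂ ∩ K(δ) there exist U ∈ ℝ^{m×r} and V ∈ ℝ^{n×r} such that U·Vᵀ = M and ⟨∇_X F̃(X,Y), X − U⟩ + ⟨∇_Y F̃(X,Y), Y − V⟩ ≥ (p/4)·‖M − X·Yᵀ‖_F², where ⟨A,B⟩ = trace(AᵀB) denotes the Frobenius inner product. -/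

import Mathlib

open Matrix
open scoped Classical

noncomputable section

/-- Frobenius norm of a real matrix. -/
def frob {m n : ℕ} (A : Matrix (Fin m) (Fin n) ℝ) : ℝ :=
  Real.sqrt (∑ i, ∑ j, A i j ^ 2)

/-- Euclidean norm of the `i`-th row of a matrix. -/
def rowNorm {m n : ℕ} (A : Matrix (Fin m) (Fin n) ℝ) (i : Fin m) : ℝ :=
  Real.sqrt (∑ j, A i j ^ 2)

/-- Frobenius inner product `⟨A,B⟩ = trace(AᵀB)`. -/
def finner {m n : ℕ} (A B : Matrix (Fin m) (Fin n) ℝ) : ℝ :=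
  ∑ i, ∑ j, A i j * B i j

/-- Projection onto the set of entries indexed by `Ω` (other entries are set to `0`). -/
def projOmega {m n : ℕ} (Ω : Finset (Fin m × Fin n)) (A : Matrix (Fin m) (Fin n) ℝ) :
    Matrix (Fin m) (Fin n) ℝ :=
  Matrix.of fun i j => if (i, j) ∈ Ω then A i j else 0

/-- `G₀(z) = (max{0, z-1})²`. -/
def G0 (z : ℝ) : ℝ := max 0 (z - 1) ^ 2

/-- `G₀′(z) = 2·max{0, z-1}`. -/
def G0' (z : ℝ) : ℝ := 2 * max 0 (z - 1)

/-- The matrix whose `i`-th row is the `i`-th row of `A` and whose other rows vanish. -/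
def rowMat {m n : ℕ} (A : Matrix (Fin m) (Fin n) ℝ) (i : Fin m) :
    Matrix (Fin m) (Fin n) ℝ :=
  Matrix.of fun i' j => if i' = i then A i j else 0

/-- The regularizer `G(X,Y)`. -/
def Greg {m n r : ℕ} (ρ β1 β2 βT : ℝ) (X : Matrix (Fin m) (Fin r) ℝ)
    (Y : Matrix (Fin n) (Fin r) ℝ) : ℝ :=
  ρ * ∑ i, G0 (3 * rowNorm X i ^ 2 / (2 * β1 ^ 2)) +
    ρ * ∑ j, G0 (3 * rowNorm Y j ^ 2 / (2 * β2 ^ 2)) +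
    ρ * G0 (3 * frob X ^ 2 / (2 * βT ^ 2)) +
    ρ * G0 (3 * frob Y ^ 2 / (2 * βT ^ 2))

/-- The regularized objective `F̃(X,Y)`. -/
def Ftilde {m n r : ℕ} (Ω : Finset (Fin m × Fin n)) (M : Matrix (Fin m) (Fin n) ℝ)
    (ρ β1 β2 βT : ℝ) (X : Matrix (Fin m) (Fin r) ℝ) (Y : Matrix (Fin n) (Fin r) ℝ) : ℝ :=
  (1 / 2) * frob (projOmega Ω (M - X * Yᵀ)) ^ 2 + Greg ρ β1 β2 βT X Y

/-- Gradient of the regularizer with respect to one of the factors. -/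
def gradG1 {m r : ℕ} (ρ β βT : ℝ) (X : Matrix (Fin m) (Fin r) ℝ) :
    Matrix (Fin m) (Fin r) ℝ :=
  (∑ i, (ρ * G0' (3 * rowNorm X i ^ 2 / (2 * β ^ 2)) * (3 / β ^ 2)) • rowMat X i) +
    (ρ * G0' (3 * frob X ^ 2 / (2 * βT ^ 2)) * (3 / βT ^ 2)) • X

/-- `∇_X F̃(X,Y)`. -/
def gradX {m n r : ℕ} (Ω : Finset (Fin m × Fin n)) (M : Matrix (Fin m) (Fin n) ℝ)
    (ρ β1 βT : ℝ) (X : Matrix (Fin m) (Fin r) ℝ) (Y : Matrix (Fin n) (Fin r) ℝ) :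
    Matrix (Fin m) (Fin r) ℝ :=
  projOmega Ω (X * Yᵀ - M) * Y + gradG1 ρ β1 βT X

/-- `∇_Y F̃(X,Y)`. -/
def gradY {m n r : ℕ} (Ω : Finset (Fin m × Fin n)) (M : Matrix (Fin m) (Fin n) ℝ)
    (ρ β2 βT : ℝ) (X : Matrix (Fin m) (Fin r) ℝ) (Y : Matrix (Fin n) (Fin r) ℝ) :
    Matrix (Fin n) (Fin r) ℝ :=
  (projOmega Ω (X * Yᵀ - M))ᵀ * X + gradG1 ρ β2 βT Y

/-- Membership in `K₁`. -/
def K1mem {m n r : ℕ} (β1 β2 : ℝ) (X : Matrix (Fin m) (Fin r) ℝ)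
    (Y : Matrix (Fin n) (Fin r) ℝ) : Prop :=
  (∀ i, rowNorm X i ≤ β1) ∧ ∀ j, rowNorm Y j ≤ β2

/-- Membership in `K₂`. -/
def K2mem {m n r : ℕ} (βT : ℝ) (X : Matrix (Fin m) (Fin r) ℝ)
    (Y : Matrix (Fin n) (Fin r) ℝ) : Prop :=
  frob X ≤ βT ∧ frob Y ≤ βT

/-- Membership in `K(t) = {(X,Y) : ‖M - XYᵀ‖_F ≤ t}`. -/
def Kmem {m n r : ℕ} (M : Matrix (Fin m) (Fin n) ℝ) (t : ℝ)
    (X : Matrix (Fin m) (Fin r) ℝ) (Y : Matrix (Fin n) (Fin r) ℝ) : Prop :=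
  frob (M - X * Yᵀ) ≤ t


section PartA
variable {ι : Type*} [Fintype ι] [DecidableEq ι]

theorem pa_diag (Y : Matrix ι ι ℝ) (hY : Y.PosSemidef) :
    ∃ (U : Matrix ι ι ℝ) (lam : ι → ℝ), U * Uᵀ = 1 ∧ Uᵀ * U = 1 ∧ (∀ i, 0 ≤ lam i) ∧
      Y = U * diagonal lam * Uᵀ := by
  have hsp := hY.1.spectral_theorem
  rw [Unitary.conjStarAlgAut_apply] at hsp
  refine ⟨(hY.1.eigenvectorUnitary).1, hY.1.eigenvalues, ?_, ?_,
    fun i => hY.eigenvalues_nonneg i, ?_⟩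
  · exact Unitary.coe_mul_star_self hY.1.eigenvectorUnitary
  · exact Unitary.coe_star_mul_self hY.1.eigenvectorUnitary
  · exact hsp

/-- spectral moments -/
theorem pa_moments (Y : Matrix ι ι ℝ) (hY : Y.PosSemidef) (x : ι → ℝ) :
    ∃ w lam : ι → ℝ, (∀ i, 0 ≤ w i) ∧ (∀ i, 0 ≤ lam i) ∧
      (∀ a : ℕ, x ⬝ᵥ (Y ^ a *ᵥ x) = ∑ i, w i * lam i ^ a) ∧ Y.trace = ∑ i, lam i := by
  obtain ⟨U, lam, hUU', hUU, hl, hsp⟩ := pa_diag Y hY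
  refine ⟨fun i => (Uᵀ *ᵥ x) i ^ 2, lam, fun i => sq_nonneg _, hl, fun a => ?_, ?_⟩
  · have hpow : Y ^ a = U * diagonal (fun i => lam i ^ a) * Uᵀ := by
      induction a with
      | zero => simp [hUU']
      | succ a ih =>
        rw [pow_succ, ih, hsp]
        have : U * diagonal (fun i => lam i ^ a) * Uᵀ * (U * diagonal lam * Uᵀ) =
          U * (diagonal (fun i => lam i ^ a) * (Uᵀ * U) * diagonal lam) * Uᵀ := by
          simp only [Matrix.mul_assoc]
        rw [this, hUU, Matrix.mul_one, diagonal_mul_diagonal]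
        congr 3
    rw [hpow, Matrix.mul_assoc, ← mulVec_mulVec, ← mulVec_mulVec, dotProduct_mulVec]
    rw [← mulVec_transpose, dotProduct]
    refine Finset.sum_congr rfl fun i _ => ?_
    rw [mulVec_diagonal]; ring
  · rw [hsp, trace_mul_comm, ← Matrix.mul_assoc, hUU, Matrix.one_mul, trace_diagonal]

theorem pa_cheb (Y : Matrix ι ι ℝ) (hY : Y.PosSemidef) (x : ι → ℝ) (a b : ℕ) :
    (x ⬝ᵥ (Y ^ a *ᵥ x)) * (x ⬝ᵥ (Y ^ b *ᵥ x)) ≤ (x ⬝ᵥ x) * (x ⬝ᵥ (Y ^ (a + b) *ᵥ x)) := by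
  obtain ⟨w, l, hw, hl, h, htr⟩ := pa_moments Y hY x
  have h0 : x ⬝ᵥ x = ∑ i, w i * l i ^ 0 := by rw [← h 0]; simp
  rw [h0, h a, h b, h (a + b)]
  have key : 0 ≤ ∑ i, ∑ j, w i * w j * ((l i ^ a - l j ^ a) * (l i ^ b - l j ^ b)) := by
    refine Finset.sum_nonneg fun i _ => Finset.sum_nonneg fun j _ => ?_
    refine mul_nonneg (mul_nonneg (hw i) (hw j)) ?_
    rcases le_total (l i) (l j) with hij | hij
    · exact mul_nonneg_of_nonpos_of_nonpos
        (sub_nonpos.2 (pow_le_pow_left₀ (hl i) hij a)) (sub_nonpos.2 (pow_le_pow_left₀ (hl i) hij b))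
    · exact mul_nonneg
        (sub_nonneg.2 (pow_le_pow_left₀ (hl j) hij a)) (sub_nonneg.2 (pow_le_pow_left₀ (hl j) hij b))
  have e : ∑ i, ∑ j, w i * w j * ((l i ^ a - l j ^ a) * (l i ^ b - l j ^ b)) =
      2 * ((∑ i, w i * l i ^ 0) * ∑ i, w i * l i ^ (a + b)) -
      2 * ((∑ i, w i * l i ^ a) * ∑ i, w i * l i ^ b) := by
    have e1 : ∑ i, ∑ j, w i * w j * ((l i ^ a - l j ^ a) * (l i ^ b - l j ^ b)) =
      ∑ i, ∑ j, ((w i * l i ^ (a+b)) * (w j * l j ^ 0) + (w i * l i ^ 0) * (w j * l j ^ (a + b))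
        - (w i * l i ^ a) * (w j * l j ^ b) - (w i * l i ^ b) * (w j * l j ^ a)) := by
      refine Finset.sum_congr rfl fun i _ => Finset.sum_congr rfl fun j _ => ?_
      ring
    rw [e1]
    simp only [Finset.sum_add_distrib, Finset.sum_sub_distrib, ← Finset.mul_sum, ← Finset.sum_mul]
    ring
  linarith

theorem pa_mom_nonneg (Y : Matrix ι ι ℝ) (hY : Y.PosSemidef) (x : ι → ℝ) (a : ℕ) :
    0 ≤ x ⬝ᵥ (Y ^ a *ᵥ x) := by
  obtain ⟨w, l, hw, hl, h, htr⟩ := pa_moments Y hY x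
  rw [h]; exact Finset.sum_nonneg fun i _ => mul_nonneg (hw i) (pow_nonneg (hl i) a)

theorem pa_jensen (Y : Matrix ι ι ℝ) (hY : Y.PosSemidef) (x : ι → ℝ) (hx : x ⬝ᵥ x = 1) (a : ℕ) :
    (x ⬝ᵥ (Y *ᵥ x)) ^ a ≤ x ⬝ᵥ (Y ^ a *ᵥ x) := by
  induction a with
  | zero => simp [hx]
  | succ a ih =>
    have h1 := pa_cheb Y hY x a 1
    rw [hx, one_mul, pow_one] at h1
    have h2 : 0 ≤ x ⬝ᵥ (Y *ᵥ x) := by simpa using pa_mom_nonneg Y hY x 1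
    calc _ = (x ⬝ᵥ (Y *ᵥ x)) ^ a * (x ⬝ᵥ (Y *ᵥ x)) := pow_succ _ _
      _ ≤ _ := mul_le_mul_of_nonneg_right ih h2
      _ ≤ _ := h1

theorem pa_trace_ge (Y : Matrix ι ι ℝ) (hY : Y.PosSemidef) (x : ι → ℝ) (hx : x ⬝ᵥ x = 1) :
    x ⬝ᵥ (Y *ᵥ x) ≤ Y.trace := by
  obtain ⟨w, l, hw, hl, h, htr⟩ := pa_moments Y hY x
  have h0 := h 0
  have h1 := h 1
  simp only [pow_zero, pow_one, mul_one, one_mulVec] at h0 h1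
  rw [h1, htr]
  refine Finset.sum_le_sum fun i _ => ?_
  have : w i ≤ 1 := by
    rw [← hx, h0]
    exact Finset.single_le_sum (fun j _ => hw j) (Finset.mem_univ i)
  nlinarith [hl i]

end PartA


section PartA2
variable {ι : Type*} [Fintype ι] [DecidableEq ι]

noncomputable def paF (K : ℕ) (Y : Matrix ι ι ℝ) : ℝ :=
  ∑ k ∈ Finset.range (K + 1), (Y ^ k).trace / (k.factorial : ℝ)

noncomputable def paG (K : ℕ) (Y : Matrix ι ι ℝ) (x : ι → ℝ) : ℝ :=
  ∑ k ∈ Finset.range K, (x ⬝ᵥ (Y ^ k *ᵥ x)) / (k.factorial : ℝ)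

theorem pa_trace_vec (A : Matrix ι ι ℝ) (x : ι → ℝ) :
    (A * vecMulVec x x).trace = x ⬝ᵥ (A *ᵥ x) := by
  rw [mul_vecMulVec, trace_vecMulVec, dotProduct_comm]

section
open scoped Matrix.Norms.Frobenius

theorem pa_deriv_lin (T : Matrix ι ι ℝ →ₗ[ℝ] ℝ) (Z X : Matrix ι ι ℝ) (k : ℕ) (t : ℝ) :
    HasDerivAt (fun t : ℝ => T ((Z + t • X) ^ k))
      (∑ i ∈ Finset.range k, T ((Z + t • X) ^ (k.pred - i) * X * (Z + t • X) ^ i)) t := by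
  have h0 : HasDerivAt (fun t : ℝ => Z + t • X) X t := by
    exact (((hasDerivAt_id t).smul_const X).const_add Z).congr_deriv (by simp)
  have h1 := h0.fun_pow' k
  have h2 := (LinearMap.toContinuousLinearMap T).hasFDerivAt.comp_hasDerivAt t h1
  have e : (LinearMap.toContinuousLinearMap T) (∑ i ∈ Finset.range k,
      (Z + t • X) ^ (k.pred - i) * X * (Z + t • X) ^ i) =
      ∑ i ∈ Finset.range k, T ((Z + t • X) ^ (k.pred - i) * X * (Z + t • X) ^ i) := by
    rw [map_sum]; rfl
  exact HasDerivAt.congr_deriv h2 e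
end

theorem pa_deriv_F (K : ℕ) (Z : Matrix ι ι ℝ) (x : ι → ℝ) (t : ℝ) :
    HasDerivAt (fun t : ℝ => paF K (Z + t • vecMulVec x x))
      (paG K (Z + t • vecMulVec x x) x) t := by
  unfold paF
  have h : ∀ k ∈ Finset.range (K + 1), HasDerivAt
      (fun t : ℝ => ((Z + t • vecMulVec x x) ^ k).trace / (k.factorial : ℝ))
      ((k * (x ⬝ᵥ ((Z + t • vecMulVec x x) ^ k.pred *ᵥ x))) / (k.factorial : ℝ)) t := by
    intro k _
    have h1 := (pa_deriv_lin (traceLinearMap ι ℝ ℝ) Z (vecMulVec x x) k t).div_const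
      (k.factorial : ℝ)
    refine h1.congr_deriv ?_
    congr 1
    symm
    rw [← nsmul_eq_mul, ← Finset.card_range k, ← Finset.sum_const, Finset.card_range]
    refine Finset.sum_congr rfl fun i hi => ?_
    rw [traceLinearMap_apply, trace_mul_comm, ← Matrix.mul_assoc, ← pow_add, pa_trace_vec]
    congr 4
    have := Finset.mem_range.1 hi
    simp only [Nat.pred_eq_sub_one]; omega
  have h2 := HasDerivAt.fun_sum h
  refine h2.congr_deriv ?_
  rw [Finset.sum_range_succ']
  simp only [paG, Nat.cast_zero, zero_mul, zero_div, add_zero]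
  refine Finset.sum_congr rfl fun k _ => ?_
  rw [Nat.factorial_succ]; push_cast
  have : (k.factorial : ℝ) ≠ 0 := by positivity
  have h3 : (k : ℝ) + 1 ≠ 0 := by positivity
  simp only [Nat.pred_eq_sub_one, Nat.add_sub_cancel]
  field_simp

theorem pa_deriv_G (K : ℕ) (Z : Matrix ι ι ℝ) (x : ι → ℝ) (t L : ℝ) (hx : x ⬝ᵥ x ≤ L)
    (hP : (Z + t • vecMulVec x x).PosSemidef) :
    ∃ g', HasDerivAt (fun t : ℝ => paG K (Z + t • vecMulVec x x) x) g' t ∧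
      g' ≤ L * paG K (Z + t • vecMulVec x x) x := by
  have hL : 0 ≤ L := le_trans (by simpa using pa_mom_nonneg _ hP x 0) hx
  let T : Matrix ι ι ℝ →ₗ[ℝ] ℝ :=
    { toFun := fun A => x ⬝ᵥ (A *ᵥ x)
      map_add' := by intro A B; simp [add_mulVec, dotProduct_add]
      map_smul' := by intro c A; simp [smul_mulVec, dotProduct_smul] }
  set Y := Z + t • vecMulVec x x with hY
  have hT : ∀ a b : ℕ, T (Y ^ a * vecMulVec x x * Y ^ b) =
      (x ⬝ᵥ (Y ^ a *ᵥ x)) * (x ⬝ᵥ (Y ^ b *ᵥ x)) := by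
    intro a b
    change x ⬝ᵥ ((Y ^ a * vecMulVec x x * Y ^ b) *ᵥ x) = _
    rw [← mulVec_mulVec, ← mulVec_mulVec, vecMulVec_mulVec, mulVec_smul, dotProduct_smul]
    simp
  have h : ∀ k ∈ Finset.range K, HasDerivAt
      (fun t : ℝ => (x ⬝ᵥ ((Z + t • vecMulVec x x) ^ k *ᵥ x)) / (k.factorial : ℝ))
      ((∑ i ∈ Finset.range k, T (Y ^ (k.pred - i) * vecMulVec x x * Y ^ i)) /
        (k.factorial : ℝ)) t := by
    intro k _
    exact (pa_deriv_lin T Z (vecMulVec x x) k t).div_const (k.factorial : ℝ)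
  refine ⟨_, HasDerivAt.fun_sum h, ?_⟩
  have hb : ∀ k, (∑ i ∈ Finset.range k, T (Y ^ (k.pred - i) * vecMulVec x x * Y ^ i)) ≤
      k * (L * (x ⬝ᵥ (Y ^ k.pred *ᵥ x))) := by
    intro k
    rw [← nsmul_eq_mul]
    conv_rhs => rw [← Finset.card_range k, ← Finset.sum_const]
    refine Finset.sum_le_sum fun i hi => ?_
    rw [hT]
    refine (pa_cheb Y hP x _ _).trans ?_
    have := Finset.mem_range.1 hi
    have e : k.pred - i + i = k.pred := by simp only [Nat.pred_eq_sub_one]; omega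
    simp only [Finset.card_range]
    rw [e]
    exact mul_le_mul_of_nonneg_right hx (pa_mom_nonneg Y hP x _)
  rcases K with _ | K
  · simp [paG]
  · rw [Finset.sum_range_succ']
    simp only [paG]
    rw [Finset.sum_range_succ, mul_add, Finset.mul_sum]
    refine add_le_add (Finset.sum_le_sum fun k _ => ?_) ?_
    · refine (div_le_div_of_nonneg_right (hb (k+1)) (by positivity)).trans (le_of_eq ?_)
      rw [Nat.factorial_succ]; push_cast
      have : (k.factorial : ℝ) ≠ 0 := by positivity
      have h3 : (k : ℝ) + 1 ≠ 0 := by positivity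
      simp only [Nat.pred_eq_sub_one, Nat.add_sub_cancel]
      field_simp
    · simp only [Finset.range_zero, Finset.sum_empty, zero_div]
      have := pa_mom_nonneg Y hP x K
      positivity

theorem pa_G_nonneg (K : ℕ) (Y : Matrix ι ι ℝ) (x : ι → ℝ) (hP : Y.PosSemidef) :
    0 ≤ paG K Y x :=
  Finset.sum_nonneg fun k _ => div_nonneg (pa_mom_nonneg Y hP x k) (by positivity)

/-- scalar comparison -/
theorem pa_scalar (f g : ℝ → ℝ) (a b L : ℝ) (hL : 0 < L) (ha : a ≤ 0) (hb : 0 ≤ b)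
    (hf : ∀ t, HasDerivAt f (g t) t)
    (hg : ∀ t ∈ Set.Icc a b, ∃ g', HasDerivAt g g' t ∧ g' ≤ L * g t) :
    ∀ t ∈ Set.Icc a b, f t ≤ f 0 + g 0 * (Real.exp (L * t) - 1) / L := by
  have hexp : ∀ t, HasDerivAt (fun t => Real.exp (-(L * t))) (-L * Real.exp (-(L*t))) t := by
    intro t
    have h1 : HasDerivAt (fun t => -(L * t)) (-L) t := by
      exact (((hasDerivAt_id t).const_mul L).neg).congr_deriv (by simp)
    simpa [mul_comm] using h1.exp
  have hexp' : ∀ t, HasDerivAt (fun t => Real.exp (L * t)) (L * Real.exp (L*t)) t := by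
    intro t
    have h1 : HasDerivAt (fun t => (L * t)) (L) t := by
      exact ((hasDerivAt_id t).const_mul L).congr_deriv (by simp)
    simpa [mul_comm] using h1.exp
  have hanti : AntitoneOn (fun t => Real.exp (-(L * t)) * g t) (Set.Icc a b) := by
    refine antitoneOn_of_deriv_nonpos (convex_Icc a b) ?_ ?_ ?_
    · intro t ht
      obtain ⟨g', h1, _⟩ := hg t ht
      exact ((hexp t).mul h1).continuousAt.continuousWithinAt
    · intro t ht
      obtain ⟨g', h1, _⟩ := hg t (interior_subset ht)
      exact ((hexp t).mul h1).differentiableAt.differentiableWithinAt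
    · intro t ht
      obtain ⟨g', h1, h2⟩ := hg t (interior_subset ht)
      have := ((hexp t).mul h1).deriv
      rw [show (fun t => Real.exp (-(L * t)) * g t) = (fun t => Real.exp (-(L * t))) * g from rfl,
        this]
      nlinarith [Real.exp_pos (-(L*t))]
  have h0 : (0:ℝ) ∈ Set.Icc a b := ⟨ha, hb⟩
  have hh : ∀ t, HasDerivAt (fun t => f 0 + g 0 * (Real.exp (L * t) - 1) / L - f t)
      (g 0 * Real.exp (L * t) - g t) t := by
    intro t
    have := (((((hexp' t).sub_const 1).const_mul (g 0)).div_const L).const_add (f 0)).sub (hf t)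
    refine this.congr_deriv ?_
    field_simp
  have hee : ∀ t, Real.exp (-(L * t)) * Real.exp (L * t) = 1 := by
    intro t; rw [← Real.exp_add]; simp
  intro t ht
  rcases le_total 0 t with h | h
  · have hm : MonotoneOn (fun t => f 0 + g 0 * (Real.exp (L * t) - 1) / L - f t) (Set.Icc 0 t) := by
      refine monotoneOn_of_deriv_nonneg (convex_Icc 0 t)
        (fun s _ => (hh s).continuousAt.continuousWithinAt)
        (fun s _ => (hh s).differentiableAt.differentiableWithinAt) ?_
      intro s hs
      have hs := interior_subset hs
      rw [(hh s).deriv]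
      have := hanti h0 ⟨ha.trans hs.1, hs.2.trans ht.2⟩ hs.1
      simp at this
      have h5 := mul_le_mul_of_nonneg_right this (Real.exp_pos (L * s)).le
      have h6 : Real.exp (-(L * s)) * g s * Real.exp (L * s) = g s := by
        rw [mul_right_comm, hee, one_mul]
      linarith
    have := hm (Set.left_mem_Icc.2 h) (Set.right_mem_Icc.2 h) h
    simp at this
    linarith
  · have hm : AntitoneOn (fun t => f 0 + g 0 * (Real.exp (L * t) - 1) / L - f t) (Set.Icc t 0) := by
      refine antitoneOn_of_deriv_nonpos (convex_Icc t 0)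
        (fun s _ => (hh s).continuousAt.continuousWithinAt)
        (fun s _ => (hh s).differentiableAt.differentiableWithinAt) ?_
      intro s hs
      have hs := interior_subset hs
      rw [(hh s).deriv]
      have := hanti ⟨ht.1.trans hs.1, hs.2.trans hb⟩ h0 hs.2
      simp at this
      have h5 := mul_le_mul_of_nonneg_right this (Real.exp_pos (L * s)).le
      have h6 : Real.exp (-(L * s)) * g s * Real.exp (L * s) = g s := by
        rw [mul_right_comm, hee, one_mul]
      linarith
    have := hm (Set.left_mem_Icc.2 h) (Set.right_mem_Icc.2 h) h
    simp at this
    linarith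

/-- one step of the trace argument -/
theorem pa_step (K : ℕ) (Z : Matrix ι ι ℝ) (x : ι → ℝ) (L q : ℝ) (hL : 0 < L)
    (hx : x ⬝ᵥ x ≤ L) (hq0 : 0 ≤ q) (hq1 : q ≤ 1)
    (hP : ∀ t : ℝ, -1 / L ≤ t → (Z + t • vecMulVec x x).PosSemidef) :
    (1 - q) * paF K (Z + ((1 - Real.exp (-1)) * q / L) • vecMulVec x x) +
      q * paF K (Z + (((1 - Real.exp (-1)) * q - 1) / L) • vecMulVec x x) ≤ paF K Z := by
  set c := 1 - Real.exp (-1) with hc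
  have hc0 : 0 ≤ c := by
    have : Real.exp (-1) ≤ 1 := Real.exp_le_one_iff.2 (by norm_num)
    linarith
  have hc1 : c ≤ 1 := by have := Real.exp_pos (-1); linarith
  have hcq : c * q ≤ 1 := by nlinarith
  have hcq0 : 0 ≤ c * q := mul_nonneg hc0 hq0
  have hs := pa_scalar (fun t => paF K (Z + t • vecMulVec x x))
    (fun t => paG K (Z + t • vecMulVec x x) x) (-1 / L) (1 / L) L hL
    (by rw [div_le_iff₀ hL]; simp) (by positivity) (fun t => pa_deriv_F K Z x t)
    (fun t ht => pa_deriv_G K Z x t L hx (hP t ht.1))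
  have h1 := hs (c * q / L) ⟨div_le_div_of_nonneg_right (by linarith) hL.le,
    div_le_div_of_nonneg_right hcq hL.le⟩
  have h2 := hs ((c * q - 1) / L) ⟨div_le_div_of_nonneg_right (by linarith) hL.le,
    div_le_div_of_nonneg_right (by linarith) hL.le⟩
  simp only [zero_smul, add_zero] at h1 h2
  rw [mul_div_cancel₀ _ hL.ne'] at h1 h2
  have hg : 0 ≤ paG K Z x := pa_G_nonneg K Z x (by
    have := hP 0 (by rw [div_le_iff₀ hL]; simp); simpa using this)
  have key : (1 - q) * (Real.exp (c * q) - 1) + q * (Real.exp (c * q - 1) - 1) ≤ 0 := by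
    have e1 : Real.exp (c * q - 1) = Real.exp (c * q) * (1 - c) := by
      rw [hc, sub_eq_add_neg, Real.exp_add]; ring
    have e2 : 1 - c * q ≤ Real.exp (-(c * q)) := Real.one_sub_le_exp_neg _
    have e3 : Real.exp (c * q) * Real.exp (-(c * q)) = 1 := by rw [← Real.exp_add]; simp
    rw [e1]
    nlinarith [Real.exp_pos (c * q)]
  have h3 := mul_le_mul_of_nonneg_left h1 (by linarith : 0 ≤ 1 - q)
  have h4 := mul_le_mul_of_nonneg_left h2 hq0
  have h5 : (1 - q) * (paG K Z x * (Real.exp (c * q) - 1) / L) +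
      q * (paG K Z x * (Real.exp (c * q - 1) - 1) / L) =
      (paG K Z x / L) * ((1 - q) * (Real.exp (c * q) - 1) + q * (Real.exp (c * q - 1) - 1)) := by
    ring
  have h6 := mul_nonpos_of_nonneg_of_nonpos (div_nonneg hg hL.le) key
  nlinarith

end PartA2


section PartA3
variable {ι : Type*} [Fintype ι] [DecidableEq ι]

theorem pa_proj_le (P : Matrix ι ι ℝ) (hs : Pᵀ = P) (hi : P * P = P) (v : ι → ℝ) :
    ∑ k, (P k ⬝ᵥ v) ^ 2 ≤ v ⬝ᵥ v := by
  have h1 : (P *ᵥ v) ⬝ᵥ (P *ᵥ v) = v ⬝ᵥ (P *ᵥ v) := by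
    rw [dotProduct_mulVec, ← mulVec_transpose, hs, mulVec_mulVec, hi, dotProduct_comm]
  have h2 : 0 ≤ (v - P *ᵥ v) ⬝ᵥ (v - P *ᵥ v) := by
    rw [dotProduct]; exact Finset.sum_nonneg fun i _ => mul_self_nonneg _
  have h3 : ∑ k, (P k ⬝ᵥ v) ^ 2 = (P *ᵥ v) ⬝ᵥ (P *ᵥ v) := by
    simp only [dotProduct, mulVec, sq]
  rw [h3]
  simp only [sub_dotProduct, dotProduct_sub] at h2
  rw [dotProduct_comm (P *ᵥ v) v] at h2
  linarith

/-- quadratic form of the partial sums -/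
theorem pa_quad (P : Matrix ι ι ℝ) (c0 : ℝ) (tau : ι → ℝ) (s : Finset ι) (v : ι → ℝ) :
    v ⬝ᵥ ((c0 • (1 : Matrix ι ι ℝ) + ∑ k ∈ s, tau k • vecMulVec (P k) (P k)) *ᵥ v) =
      c0 * (v ⬝ᵥ v) + ∑ k ∈ s, tau k * (P k ⬝ᵥ v) ^ 2 := by
  rw [add_mulVec, smul_mulVec, one_mulVec, dotProduct_add, dotProduct_smul, smul_eq_mul]
  congr 1
  rw [sum_mulVec, dotProduct_sum]
  refine Finset.sum_congr rfl fun k _ => ?_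
  rw [smul_mulVec, vecMulVec_mulVec, dotProduct_smul, dotProduct_smul]
  simp only [MulOpposite.smul_eq_mul_unop, MulOpposite.unop_op, smul_eq_mul]
  rw [dotProduct_comm v]; ring

theorem pa_psd (P : Matrix ι ι ℝ) (hs : Pᵀ = P) (hi : P * P = P) (L : ℝ) (hL : 0 < L)
    (tau : ι → ℝ) (s : Finset ι) (ht : ∀ k ∈ s, -1 / L ≤ tau k) :
    (((1 / L) • (1 : Matrix ι ι ℝ)) + ∑ k ∈ s, tau k • vecMulVec (P k) (P k)).PosSemidef := by
  refine PosSemidef.of_dotProduct_mulVec_nonneg ?_ ?_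
  · rw [IsHermitian, conjTranspose_eq_transpose_of_trivial, transpose_add, transpose_smul,
      transpose_one, transpose_sum]
    congr 1
    refine Finset.sum_congr rfl fun k _ => ?_
    rw [transpose_smul, transpose_vecMulVec]
  · intro v
    rw [star_trivial, pa_quad]
    have h1 := pa_proj_le P hs hi v
    have h2 : ∑ k ∈ s, (-1 / L) * (P k ⬝ᵥ v) ^ 2 ≤ ∑ k ∈ s, tau k * (P k ⬝ᵥ v) ^ 2 :=
      Finset.sum_le_sum fun k hk => mul_le_mul_of_nonneg_right (ht k hk) (sq_nonneg _)
    have h3 : ∑ k ∈ s, (P k ⬝ᵥ v) ^ 2 ≤ ∑ k, (P k ⬝ᵥ v) ^ 2 :=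
      Finset.sum_le_sum_of_subset_of_nonneg (Finset.subset_univ _) fun _ _ _ => sq_nonneg _
    rw [← Finset.mul_sum] at h2
    have h4 : (1 / L) * (∑ k ∈ s, (P k ⬝ᵥ v) ^ 2) ≤ (1 / L) * (v ⬝ᵥ v) :=
      mul_le_mul_of_nonneg_left (h3.trans h1) (by positivity)
    have h5 : -1 / L = - (1 / L) := by ring
    rw [h5] at h2
    linarith

noncomputable def paTau (q L : ℝ) (Ω : Finset ι) (k : ι) : ℝ :=
  if k ∈ Ω then ((1 - Real.exp (-1)) * q - 1) / L else (1 - Real.exp (-1)) * q / L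

noncomputable def paY (P : Matrix ι ι ℝ) (q L : ℝ) (s Ω : Finset ι) : Matrix ι ι ℝ :=
  ((1 / L) • (1 : Matrix ι ι ℝ)) + ∑ k ∈ s, paTau q L Ω k • vecMulVec (P k) (P k)

theorem paTau_ge (q L : ℝ) (hL : 0 < L) (hq0 : 0 ≤ q) (Ω : Finset ι) (k : ι) :
    -1 / L ≤ paTau q L Ω k := by
  have hc0 : 0 ≤ 1 - Real.exp (-1) := by
    have : Real.exp (-1) ≤ 1 := Real.exp_le_one_iff.2 (by norm_num)
    linarith
  have := mul_nonneg hc0 hq0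
  unfold paTau
  split_ifs
  · exact div_le_div_of_nonneg_right (by linarith) hL.le
  · exact div_le_div_of_nonneg_right (by linarith) hL.le

theorem pa_iter (K : ℕ) (P : Matrix ι ι ℝ) (hs : Pᵀ = P) (hi : P * P = P) (q L : ℝ) (hL : 0 < L)
    (hPL : ∀ k, P k k ≤ L) (hq0 : 0 ≤ q) (hq1 : q ≤ 1) (s : Finset ι) :
    ∑ Ω ∈ s.powerset, q ^ Ω.card * (1 - q) ^ (s.card - Ω.card) * paF K (paY P q L s Ω) ≤
      paF K ((1 / L) • (1 : Matrix ι ι ℝ)) := by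
  induction s using Finset.induction_on with
  | empty => simp [paY]
  | insert a s ha ih =>
    refine le_trans ?_ ih
    rw [Finset.sum_powerset_insert ha, ← Finset.sum_add_distrib]
    refine Finset.sum_le_sum fun Ω hΩ => ?_
    have hΩs := Finset.mem_powerset.1 hΩ
    have haΩ : a ∉ Ω := fun h => ha (hΩs h)
    have hcard := Finset.card_le_card hΩs
    rw [Finset.card_insert_of_notMem ha, Finset.card_insert_of_notMem haΩ]
    have e1 : s.card + 1 - Ω.card = (s.card - Ω.card) + 1 := by omega
    have e2 : s.card + 1 - (Ω.card + 1) = s.card - Ω.card := by omega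
    rw [e1, e2]
    have y1 : paY P q L (insert a s) Ω = paY P q L s Ω +
        ((1 - Real.exp (-1)) * q / L) • vecMulVec (P a) (P a) := by
      unfold paY
      rw [Finset.sum_insert ha, add_assoc, add_comm (paTau _ _ _ _ • _)]
      congr 3
      simp [paTau, haΩ]
    have y2 : paY P q L (insert a s) (insert a Ω) = paY P q L s Ω +
        (((1 - Real.exp (-1)) * q - 1) / L) • vecMulVec (P a) (P a) := by
      unfold paY
      rw [Finset.sum_insert ha, add_assoc, add_comm (paTau _ _ _ _ • _)]
      congr 2
      · refine Finset.sum_congr rfl fun k hk => ?_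
        have : k ≠ a := fun h => ha (h ▸ hk)
        simp [paTau, this]
      · simp [paTau]
    have hxx : P a ⬝ᵥ P a ≤ L := by
      have : P a ⬝ᵥ P a = (P * P) a a := by
        rw [mul_apply, dotProduct]
        refine Finset.sum_congr rfl fun k _ => ?_
        conv_rhs => rw [← hs]
        rw [transpose_apply, transpose_apply]
        have : P k a = P a k := by conv_lhs => rw [← hs, transpose_apply]
        rw [this]
      rw [this, hi]; exact hPL a
    have hstep := pa_step K (paY P q L s Ω) (P a) L q hL hxx hq0 hq1 (by
      intro t ht
      have := pa_psd P hs hi L hL (fun k => if k = a then t else paTau q L Ω k) (insert a s) (by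
        intro k _
        by_cases hk : k = a
        · simpa [hk] using ht
        · simpa [hk] using paTau_ge q L hL hq0 Ω k)
      convert this using 1
      unfold paY
      rw [Finset.sum_insert ha, add_assoc, if_pos rfl, add_comm (t • vecMulVec (P a) (P a))]
      congr 2
      refine Finset.sum_congr rfl fun k hk => ?_
      have : k ≠ a := fun h => ha (h ▸ hk)
      rw [if_neg this])
    rw [← y1, ← y2] at hstep
    have hw : 0 ≤ q ^ Ω.card * (1 - q) ^ (s.card - Ω.card) :=
      mul_nonneg (pow_nonneg hq0 _) (pow_nonneg (by linarith) _)
    calc _ = q ^ Ω.card * (1 - q) ^ (s.card - Ω.card) *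
          ((1 - q) * paF K (paY P q L (insert a s) Ω) +
            q * paF K (paY P q L (insert a s) (insert a Ω))) := by ring
      _ ≤ _ := mul_le_mul_of_nonneg_left hstep hw

theorem paF_one (K : ℕ) (c : ℝ) (hc : 0 ≤ c) :
    paF K (c • (1 : Matrix ι ι ℝ)) ≤ Fintype.card ι * Real.exp c := by
  unfold paF
  have : ∀ k, ((c • (1 : Matrix ι ι ℝ)) ^ k).trace / (k.factorial : ℝ) =
      Fintype.card ι * (c ^ k / (k.factorial : ℝ)) := by
    intro k
    rw [smul_pow, one_pow, trace_smul, trace_one, smul_eq_mul]; ring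
  simp only [this]
  rw [← Finset.mul_sum]
  exact mul_le_mul_of_nonneg_left (Real.sum_le_exp_of_nonneg hc _) (by positivity)

theorem paF_ge (K : ℕ) (Y : Matrix ι ι ℝ) (hY : Y.PosSemidef) (x : ι → ℝ) (hx : x ⬝ᵥ x = 1)
    (l : ℝ) (hl : 0 ≤ l) (h : l ≤ x ⬝ᵥ (Y *ᵥ x)) :
    ∑ k ∈ Finset.range (K + 1), l ^ k / (k.factorial : ℝ) ≤ paF K Y := by
  refine Finset.sum_le_sum fun k _ => div_le_div_of_nonneg_right ?_ (by positivity)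
  exact (pow_le_pow_left₀ hl h k).trans
    ((pa_jensen Y hY x hx k).trans (pa_trace_ge _ (hY.pow k) x hx))

theorem paF_nonneg (K : ℕ) (Y : Matrix ι ι ℝ) (hY : Y.PosSemidef) : 0 ≤ paF K Y :=
  Finset.sum_nonneg fun k _ => div_nonneg (hY.pow k).trace_nonneg (by positivity)

/-- The bad event for the restricted lower isometry. -/
def paBad (P : Matrix ι ι ℝ) (c : ℝ) (Ω : Finset ι) : Prop :=
  ∃ a : ι → ℝ, P *ᵥ a = a ∧ a ⬝ᵥ a = 1 ∧ ∑ k ∈ Ω, a k ^ 2 < c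

theorem pa_main (P : Matrix ι ι ℝ) (hs : Pᵀ = P) (hi : P * P = P) (q L : ℝ) (hL : 0 < L)
    (hPL : ∀ k, P k k ≤ L) (hq0 : 0 ≤ q) (hq1 : q ≤ 1) :
    ∑ Ω ∈ (Finset.univ : Finset ι).powerset.filter (paBad P (3 / 5 * q)),
      q ^ Ω.card * (1 - q) ^ (Fintype.card ι - Ω.card) ≤
      Fintype.card ι * Real.exp (-(3 / 100 * q / L)) := by
  have hgam : (63 / 100 : ℝ) ≤ 1 - Real.exp (-1) := by
    have h := Real.exp_one_gt_d9
    rw [Real.exp_neg]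
    have : (Real.exp 1)⁻¹ ≤ (2.7182818283 : ℝ)⁻¹ := inv_anti₀ (by norm_num) h.le
    have h2 : (2.7182818283 : ℝ)⁻¹ ≤ 37 / 100 := by norm_num
    linarith
  set W := ∑ Ω ∈ (Finset.univ : Finset ι).powerset.filter (paBad P (3 / 5 * q)),
      q ^ Ω.card * (1 - q) ^ (Fintype.card ι - Ω.card) with hW
  set l := 1 / L + 3 / 100 * q / L with hl
  have hl0 : 0 ≤ l := by positivity
  have hpsd : ∀ Ω, (paY P q L Finset.univ Ω).PosSemidef := fun Ω =>
    pa_psd P hs hi L hL _ _ fun k _ => paTau_ge q L hL hq0 Ω k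
  have hwt : ∀ Ω : Finset ι, 0 ≤ q ^ Ω.card * (1 - q) ^ (Fintype.card ι - Ω.card) := fun Ω =>
    mul_nonneg (pow_nonneg hq0 _) (pow_nonneg (by linarith) _)
  have hK : ∀ K : ℕ, W * ∑ k ∈ Finset.range (K + 1), l ^ k / (k.factorial : ℝ) ≤
      Fintype.card ι * Real.exp (1 / L) := by
    intro K
    refine le_trans ?_ ((pa_iter K P hs hi q L hL hPL hq0 hq1 Finset.univ).trans
      (paF_one K (1 / L) (by positivity)))
    rw [hW, Finset.sum_mul]
    refine le_trans (Finset.sum_le_sum (g := fun Ω => q ^ Ω.card * (1 - q) ^ (Finset.univ.card - Ω.card) *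
      paF K (paY P q L Finset.univ Ω)) ?_) (Finset.sum_le_sum_of_subset_of_nonneg
        (Finset.filter_subset _ _) fun Ω _ _ => mul_nonneg (hwt Ω) (paF_nonneg K _ (hpsd Ω)))
    intro Ω hΩ
    obtain ⟨a, ha1, ha2, ha3⟩ := (Finset.mem_filter.1 hΩ).2
    refine mul_le_mul_of_nonneg_left ?_ (hwt Ω)
    refine paF_ge K _ (hpsd Ω) a ha2 l hl0 ?_
    unfold paY
    rw [pa_quad, ha2, mul_one, hl]
    have hk : ∀ k, P k ⬝ᵥ a = a k := fun k => congrFun ha1 k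
    simp only [hk]
    have e : ∀ k, paTau q L Ω k * a k ^ 2 =
        (1 - Real.exp (-1)) * q / L * a k ^ 2 - (1 / L) * (if k ∈ Ω then a k ^ 2 else 0) := by
      intro k
      unfold paTau
      split_ifs
      · ring
      · ring
    simp only [e]
    rw [Finset.sum_sub_distrib, ← Finset.mul_sum, ← Finset.mul_sum]
    have e2 : ∑ k, (if k ∈ Ω then a k ^ 2 else 0) = ∑ k ∈ Ω, a k ^ 2 := by
      rw [Finset.sum_ite_mem, Finset.univ_inter]
    have e3 : ∑ k, a k ^ 2 = 1 := by rw [← ha2]; simp [dotProduct, sq]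
    rw [e2, e3]
    have h1 : (1 / L) * ∑ k ∈ Ω, a k ^ 2 ≤ (1 / L) * (3 / 5 * q) :=
      mul_le_mul_of_nonneg_left ha3.le (by positivity)
    have h2 : (63/100) * (q / L) ≤ (1 - Real.exp (-1)) * (q / L) :=
      mul_le_mul_of_nonneg_right hgam (by positivity)
    have e4 : (1 - Real.exp (-1)) * q / L * 1 = (1 - Real.exp (-1)) * (q / L) := by ring
    have e5 : (1 / L) * (3 / 5 * q) = 3 / 5 * (q / L) := by ring
    have e6 : 3 / 100 * q / L = 3 / 100 * (q / L) := by ring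
    rw [e4, e6]; rw [e5] at h1
    linarith
  have hlim : W * Real.exp l ≤ Fintype.card ι * Real.exp (1 / L) := by
    have ht : Filter.Tendsto (fun K : ℕ => W * ∑ k ∈ Finset.range (K + 1), l ^ k / (k.factorial : ℝ))
        Filter.atTop (nhds (W * Real.exp l)) := by
      refine Filter.Tendsto.const_mul _ ?_
      have h1 := (NormedSpace.expSeries_div_hasSum_exp (𝔸 := ℝ) l).tendsto_sum_nat
      rw [← Real.exp_eq_exp_ℝ] at h1
      exact h1.comp (Filter.tendsto_add_atTop_nat 1)
    exact le_of_tendsto' ht hK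
  have e1 : Real.exp l = Real.exp (1 / L) * Real.exp (3 / 100 * q / L) := by
    rw [hl, Real.exp_add]
  rw [e1] at hlim
  have hpos := Real.exp_pos (1 / L)
  have hpos2 := Real.exp_pos (3 / 100 * q / L)
  rw [Real.exp_neg, ← div_eq_mul_inv, le_div_iff₀ hpos2]
  have : (W * Real.exp (3 / 100 * q / L)) * Real.exp (1 / L) ≤ Fintype.card ι * Real.exp (1 / L) := by
    linarith
  exact le_of_mul_le_mul_right this hpos

end PartA3


section PartB1
variable {ι : Type*} [Fintype ι] [DecidableEq ι]

theorem pb_mono (bad : Finset ι → Prop) (hdc : ∀ A B : Finset ι, A ⊆ B → bad B → bad A)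
    (s : ℕ) (hs : s + 1 ≤ Fintype.card ι) :
    (((Finset.powersetCard (s+1) (Finset.univ : Finset ι)).filter bad).card : ℝ) / (Fintype.card ι).choose (s+1) ≤
    (((Finset.powersetCard s (Finset.univ : Finset ι)).filter bad).card : ℝ) / (Fintype.card ι).choose s := by
  have hsz : (((Finset.powersetCard (s+1) (Finset.univ : Finset ι)).filter bad : Finset (Finset ι)) : Set (Finset ι)).Sized (s+1) := by
    intro A hA
    have := (Finset.mem_filter.1 (Finset.mem_coe.1 hA)).1
    exact (Finset.mem_powersetCard.1 this).2
  have h := Finset.local_lubell_yamamoto_meshalkin_inequality_div (𝕜 := ℝ) (Nat.succ_ne_zero s) hsz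
  refine h.trans ?_
  simp only [Nat.succ_eq_add_one, Nat.add_sub_cancel]
  refine div_le_div_of_nonneg_right ?_ (by positivity)
  norm_cast
  refine Finset.card_le_card ?_
  intro A hA
  rw [Finset.mem_shadow_iff] at hA
  obtain ⟨B, hB, a, ha, rfl⟩ := hA
  rw [Finset.mem_filter, Finset.mem_powersetCard] at hB ⊢
  refine ⟨⟨Finset.subset_univ _, ?_⟩, hdc _ _ (Finset.erase_subset _ _) hB.2⟩
  rw [Finset.card_erase_of_mem ha, hB.1.2]; rfl

theorem pb_mono' (bad : Finset ι → Prop) (hdc : ∀ A B : Finset ι, A ⊆ B → bad B → bad A)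
    (s S : ℕ) (hsS : s ≤ S) (hs : S ≤ Fintype.card ι) :
    (((Finset.powersetCard S (Finset.univ : Finset ι)).filter bad).card : ℝ) / (Fintype.card ι).choose S ≤
    (((Finset.powersetCard s (Finset.univ : Finset ι)).filter bad).card : ℝ) / (Fintype.card ι).choose s := by
  induction S, hsS using Nat.le_induction with
  | base => exact le_rfl
  | succ k hk ih => exact (pb_mono bad hdc k hs).trans (ih (by omega))

theorem pb_half (N S : ℕ) (hS : 0 < S) (hSN : S ≤ N) (q : ℝ) (hq0 : 0 ≤ q) (hq1 : q ≤ 1)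
    (hq : q * N ≤ S / 2) :
    1 / 2 ≤ ∑ s ∈ Finset.range (S+1), (N.choose s : ℝ) * q ^ s * (1 - q) ^ (N - s) := by
  have h1 := congrArg (Polynomial.eval q) (bernsteinPolynomial.sum ℝ N)
  have h2 := congrArg (Polynomial.eval q) (bernsteinPolynomial.sum_smul ℝ N)
  simp only [Polynomial.eval_finset_sum, bernsteinPolynomial, Polynomial.eval_mul, Polynomial.eval_pow,
    Polynomial.eval_sub, Polynomial.eval_one, Polynomial.eval_X, Polynomial.eval_natCast, nsmul_eq_mul] at h1 h2
  set w : ℕ → ℝ := fun s => (N.choose s : ℝ) * q ^ s * (1 - q) ^ (N - s) with hw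
  have hw0 : ∀ s, 0 ≤ w s := fun s =>
    mul_nonneg (mul_nonneg (by positivity) (pow_nonneg hq0 _)) (pow_nonneg (by linarith) _)
  have h1' : ∑ s ∈ Finset.range (N+1), w s = 1 := h1
  have h2' : ∑ s ∈ Finset.range (N+1), (s:ℝ) * w s = N * q := h2
  have hsub : Finset.range (S+1) ⊆ Finset.range (N+1) := Finset.range_subset_range.2 (by omega)
  have h3 := Finset.sum_sdiff (f := w) hsub
  have h4 : (S:ℝ) * ∑ s ∈ Finset.range (N+1) \ Finset.range (S+1), w s ≤ N * q := by
    rw [← h2', Finset.mul_sum]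
    refine le_trans (Finset.sum_le_sum fun s hs => ?_) (Finset.sum_le_sum_of_subset_of_nonneg
      Finset.sdiff_subset fun s _ _ => mul_nonneg (by positivity) (hw0 s))
    have : S ≤ s := by
      simp only [Finset.mem_sdiff, Finset.mem_range] at hs; omega
    exact mul_le_mul_of_nonneg_right (by exact_mod_cast this) (hw0 s)
  have hSpos : (0:ℝ) < S := by exact_mod_cast hS
  have h5 : ∑ s ∈ Finset.range (N+1) \ Finset.range (S+1), w s ≤ 1/2 := by
    by_contra hc
    push Not at hc
    nlinarith
  change 1/2 ≤ ∑ s ∈ Finset.range (S+1), w s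
  linarith

theorem pb_main (bad : Finset ι → Prop) (hdc : ∀ A B : Finset ι, A ⊆ B → bad B → bad A)
    (S : ℕ) (hS : 0 < S) (hSN : S ≤ Fintype.card ι) (q : ℝ) (hq0 : 0 ≤ q) (hq1 : q ≤ 1)
    (hq : q * Fintype.card ι ≤ S / 2) :
    (((Finset.powersetCard S (Finset.univ : Finset ι)).filter bad).card : ℝ) ≤
      2 * (∑ Ω ∈ (Finset.univ : Finset ι).powerset.filter bad,
        q ^ Ω.card * (1 - q) ^ (Fintype.card ι - Ω.card)) *
        (Finset.powersetCard S (Finset.univ : Finset ι)).card := by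
  set N := Fintype.card ι with hN
  have hC : (0:ℝ) < N.choose S := by exact_mod_cast Nat.choose_pos hSN
  have hcard : ((Finset.powersetCard S (Finset.univ : Finset ι)).card : ℝ) = N.choose S := by
    rw [Finset.card_powersetCard, Finset.card_univ]
  rw [hcard, ← div_le_iff₀ hC]
  set f := (((Finset.powersetCard S (Finset.univ : Finset ι)).filter bad).card : ℝ) / N.choose S with hf
  have hf0 : 0 ≤ f := by positivity
  have hhalf := pb_half N S hS hSN q hq0 hq1 hq
  have h1 : f * ∑ s ∈ Finset.range (S+1), (N.choose s : ℝ) * q ^ s * (1 - q) ^ (N - s) ≤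
      ∑ Ω ∈ (Finset.univ : Finset ι).powerset.filter bad, q ^ Ω.card * (1 - q) ^ (N - Ω.card) := by
    have hsub : (((Finset.univ : Finset ι).powerset.filter bad).filter fun Ω => Ω.card ∈ Finset.range (S+1)) ⊆
      (Finset.univ : Finset ι).powerset.filter bad := Finset.filter_subset _ _
    refine le_trans ?_ (Finset.sum_le_sum_of_subset_of_nonneg hsub fun Ω _ _ =>
      mul_nonneg (pow_nonneg hq0 _) (pow_nonneg (by linarith) _))
    rw [← Finset.sum_fiberwise_of_maps_to (s := ((Finset.univ : Finset ι).powerset.filter bad).filter fun Ω => Ω.card ∈ Finset.range (S+1))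
      (t := Finset.range (S+1)) (g := Finset.card) (fun Ω hΩ => (Finset.mem_filter.1 hΩ).2), Finset.mul_sum]
    refine Finset.sum_le_sum fun s hs => ?_
    have hset : ((((Finset.univ : Finset ι).powerset.filter bad).filter fun Ω => Ω.card ∈ Finset.range (S+1)).filter fun Ω => Ω.card = s) =
        (Finset.powersetCard s (Finset.univ : Finset ι)).filter bad := by
      ext Ω
      simp only [Finset.mem_filter, Finset.mem_powerset, Finset.mem_powersetCard, Finset.subset_univ, true_and]
      constructor
      · rintro ⟨⟨h1, h2⟩, h3⟩; exact ⟨h3, h1⟩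
      · rintro ⟨h1, h2⟩; exact ⟨⟨h2, h1 ▸ hs⟩, h1⟩
    rw [hset]
    have hsum : ∑ Ω ∈ (Finset.powersetCard s (Finset.univ : Finset ι)).filter bad, q ^ Ω.card * (1 - q) ^ (N - Ω.card) =
        (((Finset.powersetCard s (Finset.univ : Finset ι)).filter bad).card : ℝ) * (q ^ s * (1 - q) ^ (N - s)) := by
      rw [← nsmul_eq_mul]
      refine Finset.sum_eq_card_nsmul fun Ω hΩ => ?_
      rw [(Finset.mem_powersetCard.1 (Finset.mem_filter.1 hΩ).1).2]
    rw [hsum]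
    have hsS : s ≤ S := by have := Finset.mem_range.1 hs; omega
    have hm := pb_mono' bad hdc s S hsS hSN
    have hCs : (0:ℝ) < N.choose s := by exact_mod_cast Nat.choose_pos (hsS.trans hSN)
    rw [← hN, ← hf, le_div_iff₀ hCs] at hm
    have hw : 0 ≤ q ^ s * (1 - q) ^ (N - s) := mul_nonneg (pow_nonneg hq0 _) (pow_nonneg (by linarith) _)
    have := mul_le_mul_of_nonneg_right hm hw
    linarith
  nlinarith

theorem paBad_down (P : Matrix ι ι ℝ) (c : ℝ) (A B : Finset ι) (h : A ⊆ B) (hB : paBad P c B) :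
    paBad P c A := by
  obtain ⟨a, h1, h2, h3⟩ := hB
  exact ⟨a, h1, h2, (Finset.sum_le_sum_of_subset_of_nonneg h fun _ _ _ => sq_nonneg _).trans_lt h3⟩
end PartB1


section PartB2

theorem pt_kron {m n : ℕ} (A : Matrix (Fin m) (Fin m) ℝ) (B : Matrix (Fin n) (Fin n) ℝ)
    (X : Matrix (Fin m) (Fin n) ℝ) :
    (kroneckerMap (· * ·) A B) *ᵥ (fun k : Fin m × Fin n => X k.1 k.2) = fun k => (A * X * Bᵀ) k.1 k.2 := by
  ext ⟨i, j⟩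
  simp only [mulVec, dotProduct, kroneckerMap_apply, mul_apply, transpose_apply]
  rw [Fintype.sum_prod_type, Finset.sum_comm]
  refine Finset.sum_congr rfl fun l _ => ?_
  rw [Finset.sum_mul]
  refine Finset.sum_congr rfl fun k _ => ?_
  ring

def ptBad {m n r : ℕ} (Uh : Matrix (Fin m) (Fin r) ℝ) (Vh : Matrix (Fin n) (Fin r) ℝ) (c : ℝ)
    (Ω : Finset (Fin m × Fin n)) : Prop :=
  ∃ (A : Matrix (Fin n) (Fin r) ℝ) (Z : Matrix (Fin m) (Fin r) ℝ),
    ∑ k ∈ Ω, (Uh * Aᵀ + Z * Vhᵀ) k.1 k.2 ^ 2 < c * ∑ i, ∑ j, (Uh * Aᵀ + Z * Vhᵀ) i j ^ 2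

theorem pt_main {m n r : ℕ} (Uh : Matrix (Fin m) (Fin r) ℝ) (Vh : Matrix (Fin n) (Fin r) ℝ) (μ : ℝ)
    (hn : 1 ≤ n) (hnm : n ≤ m) (hr : 1 ≤ r) (hμ : 1 ≤ μ)
    (hU : Uhᵀ * Uh = 1) (hV : Vhᵀ * Vh = 1)
    (hiU : ∀ i, ∑ k, Uh i k ^ 2 ≤ μ * r / m) (hiV : ∀ j, ∑ k, Vh j k ^ 2 ≤ μ * r / n)
    (S : ℕ) (hS : 0 < S) (hSN : S ≤ m * n) :
    (((Finset.powersetCard S (Finset.univ : Finset (Fin m × Fin n))).filter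
        (ptBad Uh Vh (3 / 10 * ((S:ℝ) / (m * n))))).card : ℝ) ≤
      2 * ((m * n) * Real.exp (-(3 / 400 * ((S:ℝ) / (m * n)) * n / (μ * r)))) *
        (Finset.powersetCard S (Finset.univ : Finset (Fin m × Fin n))).card := by
  have hn0 : (0:ℝ) < n := by exact_mod_cast hn
  have hm0 : (0:ℝ) < m := by exact_mod_cast (hn.trans hnm)
  have hr0 : (0:ℝ) < r := by exact_mod_cast hr
  have hμ0 : 0 < μ := by linarith
  have hnm' : (n:ℝ) ≤ m := by exact_mod_cast hnm
  set p : ℝ := (S:ℝ) / (m * n) with hp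
  have hp0 : 0 ≤ p := by positivity
  have hp1 : p ≤ 1 := by
    rw [hp, div_le_one (by positivity)]; exact_mod_cast hSN
  set Q1 : Matrix (Fin m) (Fin m) ℝ := 1 - Uh * Uhᵀ with hQ1
  set Q2 : Matrix (Fin n) (Fin n) ℝ := 1 - Vh * Vhᵀ with hQ2
  have hQ1s : Q1ᵀ = Q1 := by simp [hQ1]
  have hQ2s : Q2ᵀ = Q2 := by simp [hQ2]
  have hQ1U : Q1 * Uh = 0 := by rw [hQ1, Matrix.sub_mul, Matrix.one_mul, Matrix.mul_assoc, hU, Matrix.mul_one, sub_self]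
  have hQ2V : Q2 * Vh = 0 := by rw [hQ2, Matrix.sub_mul, Matrix.one_mul, Matrix.mul_assoc, hV, Matrix.mul_one, sub_self]
  have hQ1i : Q1 * Q1 = Q1 := by
    nth_rw 2 [hQ1]; rw [Matrix.mul_sub, Matrix.mul_one, ← Matrix.mul_assoc, hQ1U, Matrix.zero_mul, sub_zero]
  have hQ2i : Q2 * Q2 = Q2 := by
    nth_rw 2 [hQ2]; rw [Matrix.mul_sub, Matrix.mul_one, ← Matrix.mul_assoc, hQ2V, Matrix.zero_mul, sub_zero]
  set R : Matrix (Fin m × Fin n) (Fin m × Fin n) ℝ := kroneckerMap (· * ·) Q1 Q2 with hR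
  have hRs : Rᵀ = R := by
    ext ⟨i, j⟩ ⟨k, l⟩
    have h1 : Q1 k i = Q1 i k := by conv_lhs => rw [← hQ1s, transpose_apply]
    have h2 : Q2 l j = Q2 j l := by conv_lhs => rw [← hQ2s, transpose_apply]
    simp [hR, h1, h2]
  have hRi : R * R = R := by
    rw [hR]
    have := Matrix.mul_kronecker_mul Q1 Q1 Q2 Q2
    rw [hQ1i, hQ2i] at this
    exact this.symm
  have hPs : (1 - R)ᵀ = 1 - R := by rw [transpose_sub, transpose_one, hRs]
  have hPi : (1 - R) * (1 - R) = 1 - R := by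
    rw [Matrix.sub_mul, Matrix.mul_sub, Matrix.mul_sub, hRi]; simp
  have hL : 0 < 2 * μ * r / n := by positivity
  have hPL : ∀ k, (1 - R) k k ≤ 2 * μ * r / n := by
    rintro ⟨i, j⟩
    have e1 : Q1 i i = 1 - ∑ k, Uh i k ^ 2 := by simp [hQ1, mul_apply, sq]
    have e2 : Q2 j j = 1 - ∑ k, Vh j k ^ 2 := by simp [hQ2, mul_apply, sq]
    have : (1 - R) (i, j) (i, j) = 1 - Q1 i i * Q2 j j := by simp [hR]
    rw [this, e1, e2]
    have a1 : 0 ≤ ∑ k, Uh i k ^ 2 := Finset.sum_nonneg fun _ _ => sq_nonneg _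
    have a2 : 0 ≤ ∑ k, Vh j k ^ 2 := Finset.sum_nonneg fun _ _ => sq_nonneg _
    have b1 := hiU i
    have b2 := hiV j
    have b3 : μ * r / m ≤ μ * r / n := div_le_div_of_nonneg_left (by positivity) hn0 hnm'
    have b4 : 2 * μ * r / n = μ * r / n + μ * r / n := by ring
    nlinarith [mul_nonneg a1 a2]
  have hmain := pa_main (1 - R) hPs hPi (p / 2) (2 * μ * r / n) hL hPL (by positivity) (by linarith)
  have hcard : Fintype.card (Fin m × Fin n) = m * n := by simp
  have hcardR : (Fintype.card (Fin m × Fin n) : ℝ) = m * n := by rw [hcard]; push_cast; ring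
  have hB := pb_main (paBad (1 - R) (3 / 5 * (p / 2))) (fun A B h => paBad_down _ _ A B h) S hS
    (by rw [hcard]; exact hSN) (p / 2) (by positivity) (by linarith) (by
      rw [hcardR, hp]
      have : (S:ℝ) / (m * n) / 2 * (m * n) = S / 2 := by field_simp
      rw [this])
  have hsubset : (Finset.powersetCard S (Finset.univ : Finset (Fin m × Fin n))).filter
        (ptBad Uh Vh (3 / 10 * p)) ⊆ (Finset.powersetCard S (Finset.univ : Finset (Fin m × Fin n))).filter
        (paBad (1 - R) (3 / 5 * (p / 2))) := by
    refine Finset.monotone_filter_right _ ?_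
    rintro Ω _ ⟨A, Z, h⟩
    set X := Uh * Aᵀ + Z * Vhᵀ with hX
    set N := ∑ i, ∑ j, X i j ^ 2 with hN
    have hN0 : 0 ≤ N := Finset.sum_nonneg fun _ _ => Finset.sum_nonneg fun _ _ => sq_nonneg _
    have hl0 : 0 ≤ ∑ k ∈ Ω, X k.1 k.2 ^ 2 := Finset.sum_nonneg fun _ _ => sq_nonneg _
    have hNpos : 0 < N := by
      rcases hN0.lt_or_eq with h' | h'
      · exact h'
      · rw [← h', mul_zero] at h; linarith
    set t := (Real.sqrt N)⁻¹ with ht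
    have ht2 : t ^ 2 * N = 1 := by
      rw [ht, inv_pow, Real.sq_sqrt hN0, inv_mul_cancel₀ hNpos.ne']
    have ht0 : 0 < t ^ 2 := by
      have := Real.sqrt_pos.2 hNpos
      positivity
    refine ⟨fun k => (t • X) k.1 k.2, ?_, ?_, ?_⟩
    · rw [sub_mulVec, one_mulVec, hR, pt_kron]
      have : Q1 * (t • X) * Q2ᵀ = 0 := by
        rw [Matrix.mul_smul, Matrix.smul_mul, hX, Matrix.mul_add, ← Matrix.mul_assoc, hQ1U, Matrix.zero_mul, zero_add,
          Matrix.mul_assoc, Matrix.mul_assoc, ← Matrix.transpose_mul, hQ2V]; simp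
      rw [this]; ext k; simp
    · rw [← ht2, hN]
      simp only [dotProduct, Fintype.sum_prod_type, Matrix.smul_apply, smul_eq_mul, Finset.mul_sum]
      refine Finset.sum_congr rfl fun i _ => Finset.sum_congr rfl fun j _ => by ring
    · have e : ∑ k ∈ Ω, ((t • X) k.1 k.2) ^ 2 = t ^ 2 * ∑ k ∈ Ω, X k.1 k.2 ^ 2 := by
        rw [Finset.mul_sum]; exact Finset.sum_congr rfl fun k _ => by simp [mul_pow]
      rw [e]
      have := mul_lt_mul_of_pos_left h ht0
      nlinarith
  have h1 : (((Finset.powersetCard S (Finset.univ : Finset (Fin m × Fin n))).filter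
        (ptBad Uh Vh (3 / 10 * p))).card : ℝ) ≤ ((Finset.powersetCard S (Finset.univ : Finset (Fin m × Fin n))).filter
        (paBad (1 - R) (3 / 5 * (p / 2)))).card := by exact_mod_cast Finset.card_le_card hsubset
  refine h1.trans (hB.trans ?_)
  refine mul_le_mul_of_nonneg_right ?_ (by positivity)
  refine mul_le_mul_of_nonneg_left ?_ (by norm_num)
  rw [hcardR] at hmain
  refine hmain.trans (le_of_eq ?_)
  congr 3
  field_simp
  ring
end PartB2


section PartD1

theorem pd_choose (k : ℕ) : ∀ N S : ℕ, k ≤ S → S ≤ N →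
    (((N - k).choose (S - k) : ℕ) : ℝ) ≤ ((S:ℝ) / N) ^ k * (N.choose S : ℕ) := by
  induction k with
  | zero => intro N S _ _; simp
  | succ k ih =>
    intro N S hk hS
    obtain ⟨S, rfl⟩ : ∃ S', S = S' + 1 := ⟨S - 1, by omega⟩
    obtain ⟨N, rfl⟩ : ∃ N', N = N' + 1 := ⟨N - 1, by omega⟩
    have h := ih N S (by omega) (by omega)
    rw [Nat.add_sub_add_right, Nat.add_sub_add_right]
    have hc : ((N:ℝ) + 1) * (N.choose S : ℕ) = ((N+1).choose (S+1) : ℕ) * ((S:ℝ) + 1) := by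
      exact_mod_cast Nat.add_one_mul_choose_eq N S
    have hc' : ((N.choose S : ℕ) : ℝ) = (((S + 1 : ℕ):ℝ) / ((N + 1 : ℕ) : ℝ)) * ((N+1).choose (S+1) : ℕ) := by
      push_cast
      field_simp
      linarith
    have hle : (S:ℝ) / N ≤ ((S + 1 : ℕ):ℝ) / ((N + 1 : ℕ) : ℝ) := by
      have hSN : (S:ℝ) ≤ N := by exact_mod_cast (by omega : S ≤ N)
      push_cast
      rcases Nat.eq_zero_or_pos N with h0 | h0
      · subst h0; simp; positivity
      · have : (0:ℝ) < N := by exact_mod_cast h0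
        rw [div_le_div_iff₀ this (by positivity)]
        nlinarith
    refine h.trans ?_
    rw [hc', pow_succ, mul_assoc]
    exact mul_le_mul_of_nonneg_right (pow_le_pow_left₀ (by positivity) hle k) (by positivity)

variable {ι : Type*} [Fintype ι] [DecidableEq ι]

theorem pd_super (K : Finset ι) (S : ℕ) (hS : S ≤ Fintype.card ι) :
    (((Finset.powersetCard S (Finset.univ : Finset ι)).filter (fun Ω => K ⊆ Ω)).card : ℝ) ≤
      ((S:ℝ) / Fintype.card ι) ^ K.card * (Finset.powersetCard S (Finset.univ : Finset ι)).card := by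
  rw [Finset.card_powersetCard, Finset.card_univ]
  by_cases hk : K.card ≤ S
  · refine le_trans ?_ (pd_choose K.card (Fintype.card ι) S hk hS)
    have : ((Finset.powersetCard S (Finset.univ : Finset ι)).filter (fun Ω => K ⊆ Ω)).card ≤
        (Finset.powersetCard (S - K.card) (Finset.univ \ K)).card := by
      refine Finset.card_le_card_of_injOn (fun Ω => Ω \ K) ?_ ?_
      · intro Ω hΩ
        have hΩ' := Finset.mem_filter.1 (Finset.mem_coe.1 hΩ)
        have h2 := (Finset.mem_powersetCard.1 hΩ'.1).2
        refine Finset.mem_coe.2 (Finset.mem_powersetCard.2 ⟨Finset.sdiff_subset_sdiff (Finset.subset_univ _) le_rfl, ?_⟩)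
        rw [Finset.card_sdiff_of_subset hΩ'.2, h2]
      · intro Ω hΩ Ω' hΩ' h
        have h1 := (Finset.mem_filter.1 (Finset.mem_coe.1 hΩ)).2
        have h2 := (Finset.mem_filter.1 (Finset.mem_coe.1 hΩ')).2
        have h : Ω \ K = Ω' \ K := h
        rw [← Finset.sdiff_union_of_subset h1, ← Finset.sdiff_union_of_subset h2, h]
    rw [Finset.card_powersetCard, Finset.card_sdiff_of_subset (Finset.subset_univ _), Finset.card_univ] at this
    exact_mod_cast this
  · have : (Finset.powersetCard S (Finset.univ : Finset ι)).filter (fun Ω => K ⊆ Ω) = ∅ := by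
      refine Finset.filter_eq_empty_iff.2 fun Ω hΩ h => hk ?_
      have := Finset.card_le_card h
      rwa [(Finset.mem_powersetCard.1 hΩ).2] at this
    rw [this]; simp; positivity

theorem pd_tail (B : Finset ι) (k S : ℕ) (hS : S ≤ Fintype.card ι) :
    (((Finset.powersetCard S (Finset.univ : Finset ι)).filter (fun Ω => k ≤ (Ω ∩ B).card)).card : ℝ) ≤
      (B.card.choose k : ℕ) * ((S:ℝ) / Fintype.card ι) ^ k * (Finset.powersetCard S (Finset.univ : Finset ι)).card := by
  have hsub : (Finset.powersetCard S (Finset.univ : Finset ι)).filter (fun Ω => k ≤ (Ω ∩ B).card) ⊆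
      (Finset.powersetCard k B).biUnion fun K => (Finset.powersetCard S (Finset.univ : Finset ι)).filter (fun Ω => K ⊆ Ω) := by
    intro Ω hΩ
    obtain ⟨h1, h2⟩ := Finset.mem_filter.1 hΩ
    obtain ⟨K, hK, hKc⟩ := Finset.exists_subset_card_eq h2
    refine Finset.mem_biUnion.2 ⟨K, Finset.mem_powersetCard.2 ⟨hK.trans Finset.inter_subset_right, hKc⟩,
      Finset.mem_filter.2 ⟨h1, hK.trans Finset.inter_subset_left⟩⟩
  have h1 := (Finset.card_le_card hsub).trans Finset.card_biUnion_le
  have h2 : (((Finset.powersetCard S (Finset.univ : Finset ι)).filter (fun Ω => k ≤ (Ω ∩ B).card)).card : ℝ) ≤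
     ∑ K ∈ Finset.powersetCard k B, (((Finset.powersetCard S (Finset.univ : Finset ι)).filter (fun Ω => K ⊆ Ω)).card : ℝ) := by
    exact_mod_cast h1
  refine h2.trans ?_
  refine (Finset.sum_le_card_nsmul _ _ (((S:ℝ) / Fintype.card ι) ^ k * (Finset.powersetCard S (Finset.univ : Finset ι)).card) ?_).trans ?_
  · intro K hK
    have := pd_super K S hS
    rwa [(Finset.mem_powersetCard.1 hK).2] at this
  · rw [Finset.card_powersetCard, nsmul_eq_mul, mul_assoc]

theorem pd_chooseexp (b k : ℕ) (hk : 0 < k) (hb : 0 < b) (p : ℝ) (hp : 0 < p) :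
    (b.choose k : ℝ) * p ^ k ≤ Real.exp (-(k * Real.log (k / (Real.exp 1 * p * b)))) := by
  have hk0 : (0:ℝ) < k := by exact_mod_cast hk
  have hb0 : (0:ℝ) < b := by exact_mod_cast hb
  have h1 : (b.choose k : ℝ) ≤ (b:ℝ) ^ k / (k.factorial : ℝ) := Nat.choose_le_pow_div k b
  have h2 := Real.pow_div_factorial_le_exp (k:ℝ) hk0.le k
  have e : Real.exp (-(k * Real.log (k / (Real.exp 1 * p * b)))) = (Real.exp 1 * p * b / k) ^ k := by
    rw [← mul_neg, ← Real.log_inv, inv_div, Real.exp_nat_mul, Real.exp_log (by positivity)]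
  rw [e, div_pow, mul_pow, mul_pow, ← Real.exp_nat_mul, mul_one]
  have hf : (0:ℝ) < (k.factorial : ℝ) := by positivity
  rw [div_le_iff₀ hf] at h2
  calc (b.choose k : ℝ) * p ^ k ≤ (b:ℝ) ^ k / (k.factorial : ℝ) * p ^ k :=
        mul_le_mul_of_nonneg_right h1 (by positivity)
    _ = ((p ^ k * b ^ k) * (k:ℝ)^k) / ((k.factorial : ℝ) * (k:ℝ)^k) := by field_simp
    _ ≤ ((p ^ k * b ^ k) * (Real.exp k * (k.factorial : ℝ))) / ((k.factorial : ℝ) * (k:ℝ)^k) := by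
        refine div_le_div_of_nonneg_right (mul_le_mul_of_nonneg_left h2 (by positivity)) (by positivity)
    _ = _ := by field_simp

theorem pd_scalar (k a1 a2 p s t m h : ℝ) (hs : 0 < s) (ht : 0 < t) (hp : 0 < p) (hm : 0 < m) (hh : 1 ≤ h)
    (hsm : s ≤ m) (hk1 : a1 * s ≤ k) (hk2 : a2 * t ≤ k) (hk3 : Real.exp 2 * p * s * t ≤ k)
    (ha2 : a2 = p * m / h) (ha1 : 64 * h ≤ a1) :
    16 * (s * Real.log (Real.exp 1 * m / s)) ≤ k * Real.log (k / (Real.exp 1 * p * (s * t))) := by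
  have hkpos : 0 < k := lt_of_lt_of_le (by positivity) hk3
  set x := Real.log (Real.exp 1 * m / s) with hx
  have hxe : x = 1 + Real.log (m / s) := by
    rw [hx, mul_div_assoc, Real.log_mul (by positivity) (by positivity), Real.log_exp]
  have hx1 : 1 ≤ x := by
    rw [hxe]
    have := Real.log_nonneg ((one_le_div hs).2 hsm)
    linarith
  set y := Real.log (k / (Real.exp 1 * p * (s * t))) with hy
  have hD : 0 < Real.exp 1 * p * (s * t) := by positivity
  have hy1 : 1 ≤ y := by
    rw [hy, Real.le_log_iff_exp_le (by positivity), le_div_iff₀ hD]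
    refine le_trans (le_of_eq ?_) hk3
    have : Real.exp 2 = Real.exp 1 * Real.exp 1 := by rw [← Real.exp_add]; norm_num
    rw [this]; ring
  by_cases hc : x ≤ a1 / 16
  · have : 16 * (s * x) ≤ a1 * s := by nlinarith
    nlinarith
  · push Not at hc
    have hy2 : x - 2 - Real.log h ≤ y := by
      have e : x - 2 - Real.log h = Real.log (a2 * t / (Real.exp 1 * p * (s * t))) := by
        have : a2 * t / (Real.exp 1 * p * (s * t)) = (m / s) / (Real.exp 1 * h) := by
          rw [ha2]; field_simp
        rw [this, Real.log_div (by positivity) (by positivity), Real.log_mul (by positivity) (by positivity), Real.log_exp, hxe]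
        ring
      rw [e, hy]
      have : 0 < a2 := by rw [ha2]; positivity
      exact Real.log_le_log (by positivity) (div_le_div_of_nonneg_right hk2 hD.le)
    have hlog := Real.log_le_sub_one_of_pos (by linarith : 0 < h)
    have hy3 : x / 2 ≤ y := by linarith
    have h32 : 32 ≤ a1 := by linarith
    have : 32 * s ≤ k := le_trans (mul_le_mul_of_nonneg_right h32 hs.le) hk1
    have h5 : (32 * s) * (x / 2) ≤ k * y := mul_le_mul this hy3 (by linarith) hkpos.le
    linarith

theorem pd_ell (s m : ℝ) (hs : 1 ≤ s) (hsm : s ≤ m) :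
    1 + Real.log m ≤ s * Real.log (Real.exp 1 * m / s) := by
  have hm : 0 < m := by linarith
  rw [mul_div_assoc, Real.log_mul (by positivity) (by positivity), Real.log_exp,
    Real.log_div (by positivity) (by positivity)]
  have h1 := Real.log_le_log (by linarith) hsm
  have h2 := Real.log_le_sub_one_of_pos (by linarith : 0 < s)
  nlinarith

theorem pd_choose_ell (m s : ℕ) (hs : 1 ≤ s) (hm : 1 ≤ m) :
    (m.choose s : ℝ) ≤ Real.exp (s * Real.log (Real.exp 1 * m / s)) := by
  have := pd_chooseexp m s hs hm 1 one_pos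
  rw [one_pow, mul_one, mul_one, ← mul_neg, ← Real.log_inv, inv_div] at this
  exact this

theorem pd_sum (m : ℕ) (hm : 1 ≤ m) :
    ∑ A ∈ (Finset.univ : Finset (Finset (Fin m))).filter (fun A => A.Nonempty),
      Real.exp (-(8 * (A.card * Real.log (Real.exp 1 * m / A.card)))) ≤ 1 / (2 * (m:ℝ) ^ 2) := by
  have hm0 : (1:ℝ) ≤ m := by exact_mod_cast hm
  set f : ℕ → ℝ := fun s => Real.exp (-(8 * (s * Real.log (Real.exp 1 * m / s)))) with hf
  rw [← Finset.sum_fiberwise_of_maps_to (t := Finset.Icc 1 m) (g := Finset.card)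
    (fun A hA => Finset.mem_Icc.2 ⟨(Finset.mem_filter.1 hA).2.card_pos, by simpa using Finset.card_le_univ A⟩)]
  have hterm : ∀ s ∈ Finset.Icc 1 m, ∑ A ∈ ((Finset.univ : Finset (Finset (Fin m))).filter (fun A => A.Nonempty)).filter (fun A => A.card = s),
      Real.exp (-(8 * (A.card * Real.log (Real.exp 1 * m / A.card)))) ≤ Real.exp (-(7 * (1 + Real.log m))) := by
    intro s hs
    obtain ⟨hs1, hs2⟩ := Finset.mem_Icc.1 hs
    have hset : ((Finset.univ : Finset (Finset (Fin m))).filter (fun A => A.Nonempty)).filter (fun A => A.card = s) =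
        Finset.powersetCard s Finset.univ := by
      ext A
      simp only [Finset.mem_filter, Finset.mem_univ, true_and, Finset.mem_powersetCard, Finset.subset_univ]
      constructor
      · exact fun h => h.2
      · intro h; exact ⟨Finset.card_pos.1 (by omega), h⟩
    rw [hset, Finset.sum_eq_card_nsmul (b := f s) (fun A hA => by rw [(Finset.mem_powersetCard.1 hA).2]),
      Finset.card_powersetCard, Finset.card_univ, Fintype.card_fin, nsmul_eq_mul]
    have h1 := pd_choose_ell m s hs1 hm
    have h2 := pd_ell s m (by exact_mod_cast hs1) (by exact_mod_cast hs2)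
    calc (m.choose s : ℝ) * f s ≤ Real.exp (s * Real.log (Real.exp 1 * m / s)) * f s :=
          mul_le_mul_of_nonneg_right h1 (Real.exp_pos _).le
      _ = Real.exp (-(7 * (s * Real.log (Real.exp 1 * m / s)))) := by
          rw [hf, ← Real.exp_add]; congr 1; ring
      _ ≤ _ := Real.exp_le_exp.2 (by linarith)
  refine (Finset.sum_le_card_nsmul _ _ _ hterm).trans ?_
  rw [Nat.card_Icc, Nat.add_sub_cancel, nsmul_eq_mul]
  have e : Real.exp (-(7 * (1 + Real.log m))) = Real.exp (-7) * ((m:ℝ) ^ 7)⁻¹ := by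
    have : -(7 * (1 + Real.log m)) = -7 + -((7:ℕ) * Real.log m) := by push_cast; ring
    rw [this, Real.exp_add, Real.exp_neg ((7:ℕ) * _), Real.exp_nat_mul, Real.exp_log (by linarith)]
  rw [e]
  have h7 : Real.exp (-7) ≤ 1 / 2 := by
    have := Real.add_one_le_exp (7:ℝ)
    rw [Real.exp_neg]
    rw [inv_eq_one_div]
    exact one_div_le_one_div_of_le (by norm_num) (by linarith)
  have hpow : (m:ℝ) * ((m:ℝ) ^ 7)⁻¹ ≤ ((m:ℝ)^2)⁻¹ := by
    have : (m:ℝ) * ((m:ℝ) ^ 7)⁻¹ = ((m:ℝ)^6)⁻¹ := by field_simp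
    rw [this]
    exact inv_anti₀ (by positivity) (pow_le_pow_right₀ hm0 (by norm_num))
  calc (m:ℝ) * (Real.exp (-7) * ((m:ℝ) ^ 7)⁻¹) = Real.exp (-7) * ((m:ℝ) * ((m:ℝ) ^ 7)⁻¹) := by ring
    _ ≤ 1 / 2 * ((m:ℝ)^2)⁻¹ := mul_le_mul h7 hpow (by positivity) (by norm_num)
    _ = _ := by field_simp
end PartD1


section PartD2

def pdBad {m n : ℕ} (p a1 a2 : ℝ) (Ω : Finset (Fin m × Fin n)) : Prop :=
  ∃ (A : Finset (Fin m)) (B : Finset (Fin n)), A.Nonempty ∧ B.Nonempty ∧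
    Real.exp 2 * p * A.card * B.card + a1 * A.card + a2 * B.card < ((Ω ∩ A ×ˢ B).card : ℝ)

theorem pd_main {m n : ℕ} (hn : 1 ≤ n) (hnm : n ≤ m) (S : ℕ) (hS : 0 < S) (hSN : S ≤ m * n)
    (p a1 a2 h h' : ℝ) (hp : p = (S:ℝ) / (m * n)) (hh : 1 ≤ h) (hh' : 1 ≤ h')
    (ha1 : a1 = p * n / h) (ha2 : a2 = p * m / h') (hb1 : 64 * h' ≤ a1) (hb2 : 64 * h ≤ a2) :
    (((Finset.powersetCard S (Finset.univ : Finset (Fin m × Fin n))).filter (pdBad p a1 a2)).card : ℝ) ≤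
      1 / (4 * (n:ℝ) ^ 4) * (Finset.powersetCard S (Finset.univ : Finset (Fin m × Fin n))).card := by
  have hm : 1 ≤ m := hn.trans hnm
  have hn0 : (0:ℝ) < n := by exact_mod_cast hn
  have hm0 : (0:ℝ) < m := by exact_mod_cast hm
  have hS0 : (0:ℝ) < S := by exact_mod_cast hS
  have hnm' : (n:ℝ) ≤ m := by exact_mod_cast hnm
  have hp0 : 0 < p := by rw [hp]; positivity
  have hcard : Fintype.card (Fin m × Fin n) = m * n := by simp
  have hcardR : (S:ℝ) / (Fintype.card (Fin m × Fin n) : ℝ) = p := by rw [hcard, hp]; push_cast; ring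
  set PC := Finset.powersetCard S (Finset.univ : Finset (Fin m × Fin n)) with hPC
  set lm : Finset (Fin m) → ℝ := fun A => Real.exp (-(8 * (A.card * Real.log (Real.exp 1 * m / A.card)))) with hlm
  set ln : Finset (Fin n) → ℝ := fun A => Real.exp (-(8 * (A.card * Real.log (Real.exp 1 * n / A.card)))) with hln
  have key : ∀ (A : Finset (Fin m)) (B : Finset (Fin n)), A.Nonempty → B.Nonempty →
      ((PC.filter fun Ω => Real.exp 2 * p * A.card * B.card + a1 * A.card + a2 * B.card < ((Ω ∩ A ×ˢ B).card : ℝ)).card : ℝ)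
        ≤ lm A * ln B * PC.card := by
    intro A B hA hB
    have hs : (0:ℝ) < A.card := by exact_mod_cast hA.card_pos
    have ht : (0:ℝ) < B.card := by exact_mod_cast hB.card_pos
    have hsm : (A.card:ℝ) ≤ m := by exact_mod_cast (by simpa using Finset.card_le_univ A)
    have htn : (B.card:ℝ) ≤ n := by exact_mod_cast (by simpa using Finset.card_le_univ B)
    set Kr := Real.exp 2 * p * A.card * B.card + a1 * A.card + a2 * B.card with hKr
    have ha10 : 0 < a1 := by linarith
    have ha20 : 0 < a2 := by linarith
    have c1 : 0 < Real.exp 2 * p * A.card * B.card := by positivity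
    have c2 : 0 < a1 * A.card := by positivity
    have c3 : 0 < a2 * B.card := by positivity
    set k := ⌊Kr⌋₊ + 1 with hk
    have hkr : Kr < (k:ℝ) := by rw [hk]; push_cast; exact Nat.lt_floor_add_one Kr
    have hsub : (PC.filter fun Ω => Kr < ((Ω ∩ A ×ˢ B).card : ℝ)) ⊆ PC.filter fun Ω => k ≤ (Ω ∩ A ×ˢ B).card := by
      refine Finset.monotone_filter_right _ ?_
      intro Ω _ h
      exact (Nat.floor_lt (by linarith)).2 h
    have h1 : ((PC.filter fun Ω => Kr < ((Ω ∩ A ×ˢ B).card : ℝ)).card : ℝ) ≤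
        (PC.filter fun Ω => k ≤ (Ω ∩ A ×ˢ B).card).card := by exact_mod_cast Finset.card_le_card hsub
    refine h1.trans ((pd_tail (A ×ˢ B) k S (by rw [hcard]; exact hSN)).trans ?_)
    refine mul_le_mul_of_nonneg_right ?_ (by positivity)
    rw [hcardR]
    refine (pd_chooseexp (A ×ˢ B).card k (by omega) (Finset.card_pos.2 (hA.product hB)) p hp0).trans ?_
    rw [hlm, hln]
    simp only
    rw [← Real.exp_add, Real.exp_le_exp, Finset.card_product]
    push_cast
    have s1 := pd_scalar k a1 a2 p A.card B.card m h' hs ht hp0 hm0 hh' hsm (by linarith) (by linarith) (by linarith) ha2 hb1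
    have s2 := pd_scalar k a2 a1 p B.card A.card n h ht hs hp0 hn0 hh htn (by linarith) (by linarith)
      (by have : Real.exp 2 * p * B.card * A.card = Real.exp 2 * p * A.card * B.card := by ring
          linarith) ha1 hb2
    rw [mul_comm (B.card:ℝ) (A.card:ℝ)] at s2
    linarith
  set FA := (Finset.univ : Finset (Finset (Fin m))).filter (fun A => A.Nonempty) with hFA
  set FB := (Finset.univ : Finset (Finset (Fin n))).filter (fun A => A.Nonempty) with hFB
  have hsub : PC.filter (pdBad p a1 a2) ⊆ (FA ×ˢ FB).biUnion fun AB =>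
      PC.filter fun Ω => Real.exp 2 * p * AB.1.card * AB.2.card + a1 * AB.1.card + a2 * AB.2.card < ((Ω ∩ AB.1 ×ˢ AB.2).card : ℝ) := by
    intro Ω hΩ
    obtain ⟨h1, A, B, hA, hB, h2⟩ := Finset.mem_filter.1 hΩ
    refine Finset.mem_biUnion.2 ⟨(A, B), ?_, Finset.mem_filter.2 ⟨h1, h2⟩⟩
    simp [hFA, hFB, hA, hB]
  have h1 : ((PC.filter (pdBad p a1 a2)).card : ℝ) ≤ ∑ AB ∈ FA ×ˢ FB,
      ((PC.filter fun Ω => Real.exp 2 * p * AB.1.card * AB.2.card + a1 * AB.1.card + a2 * AB.2.card < ((Ω ∩ AB.1 ×ˢ AB.2).card : ℝ)).card : ℝ) := by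
    exact_mod_cast (Finset.card_le_card hsub).trans Finset.card_biUnion_le
  have h2 : ((PC.filter (pdBad p a1 a2)).card : ℝ) ≤ ∑ AB ∈ FA ×ˢ FB, lm AB.1 * ln AB.2 * PC.card := by
    refine h1.trans (Finset.sum_le_sum fun AB hAB => ?_)
    rw [Finset.mem_product] at hAB
    exact key AB.1 AB.2 (Finset.mem_filter.1 hAB.1).2 (Finset.mem_filter.1 hAB.2).2
  rw [← Finset.sum_mul, Finset.sum_product] at h2
  simp only [← Finset.mul_sum] at h2
  rw [← Finset.sum_mul] at h2
  refine h2.trans (mul_le_mul_of_nonneg_right ?_ (by positivity))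
  have q1 := pd_sum m hm
  have q2 := pd_sum n hn
  have q3 : (∑ A ∈ FA, lm A) * (∑ B ∈ FB, ln B) ≤ 1 / (2 * (m:ℝ) ^ 2) * (1 / (2 * (n:ℝ) ^ 2)) :=
    mul_le_mul q1 q2 (Finset.sum_nonneg fun _ _ => (Real.exp_pos _).le) (by positivity)
  refine q3.trans ?_
  have e : 1 / (2 * (m:ℝ) ^ 2) * (1 / (2 * (n:ℝ) ^ 2)) = 1 / (4 * ((m:ℝ)^2 * (n:ℝ)^2)) := by field_simp; norm_num
  rw [e]
  refine one_div_le_one_div_of_le (by positivity) ?_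
  have : (n:ℝ)^2 ≤ (m:ℝ)^2 := pow_le_pow_left₀ hn0.le hnm' 2
  nlinarith [sq_nonneg (n:ℝ)]

theorem pd_lin {ι : Type*} [Fintype ι] (c x : ι → ℝ) (h0 : ∀ i, 0 ≤ x i) (h1 : ∀ i, x i ≤ 1) :
    ∑ i, x i * c i ≤ ∑ i ∈ Finset.univ.filter (fun i => 0 < c i), c i := by
  rw [Finset.sum_filter]
  refine Finset.sum_le_sum fun i _ => ?_
  split_ifs with h
  · nlinarith [h1 i]
  · push Not at h; nlinarith [h0 i]

theorem pd_det {m n : ℕ} (p a1 a2 : ℝ) (ha1 : 0 ≤ a1) (ha2 : 0 ≤ a2) (Ω : Finset (Fin m × Fin n))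
    (hgood : ¬ pdBad p a1 a2 Ω)
    (x : Fin m → ℝ) (y : Fin n → ℝ) (hx0 : ∀ i, 0 ≤ x i) (hx1 : ∀ i, x i ≤ 1)
    (hy0 : ∀ i, 0 ≤ y i) (hy1 : ∀ i, y i ≤ 1) :
    ∑ k ∈ Ω, x k.1 * y k.2 ≤ Real.exp 2 * p * (∑ i, x i) * (∑ j, y j) + a1 * ∑ i, x i + a2 * ∑ j, y j := by
  set e : Fin m → Fin n → ℝ := fun i j => if (i, j) ∈ Ω then 1 else 0 with he
  have hcount : ∀ (A : Finset (Fin m)) (B : Finset (Fin n)),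
      ∑ i ∈ A, ∑ j ∈ B, e i j ≤ Real.exp 2 * p * A.card * B.card + a1 * A.card + a2 * B.card := by
    intro A B
    have e1 : ∑ i ∈ A, ∑ j ∈ B, e i j = ((Ω ∩ A ×ˢ B).card : ℝ) := by
      rw [← Finset.sum_product' A B e, Finset.inter_comm, ← Finset.filter_mem_eq_inter, Finset.card_filter]
      push_cast
      rfl
    by_cases hA : A.Nonempty
    · by_cases hB : B.Nonempty
      · rw [e1]
        by_contra hc
        push Not at hc
        exact hgood ⟨A, B, hA, hB, hc⟩
      · rw [Finset.not_nonempty_iff_eq_empty] at hB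
        subst hB; simp; positivity
    · rw [Finset.not_nonempty_iff_eq_empty] at hA
      subst hA; simp; positivity
  have e0 : ∑ k ∈ Ω, x k.1 * y k.2 = ∑ i, ∑ j, x i * y j * e i j := by
    rw [← Fintype.sum_prod_type', ← Finset.univ_inter Ω, ← Finset.sum_ite_mem]
    refine Finset.sum_congr rfl fun k _ => ?_
    rw [he]; simp
  rw [e0]
  set c : Fin m → ℝ := fun i => ∑ j, y j * (e i j - Real.exp 2 * p) - a1 with hc
  set A := Finset.univ.filter (fun i => 0 < c i) with hA
  have s1 := pd_lin c x hx0 hx1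
  set d : Fin n → ℝ := fun j => ∑ i ∈ A, (e i j - Real.exp 2 * p) - a2 with hd
  set B := Finset.univ.filter (fun j => 0 < d j) with hB
  have s2 := pd_lin d y hy0 hy1
  have s3 := hcount A B
  have t1 : ∑ i, x i * c i = ∑ i, ∑ j, x i * y j * e i j - Real.exp 2 * p * (∑ i, x i) * (∑ j, y j) - a1 * ∑ i, x i := by
    have : ∀ i, x i * c i = ∑ j, x i * y j * e i j - (Real.exp 2 * p * ∑ j, y j) * x i - a1 * x i := by
      intro i
      simp only [hc, mul_sub, Finset.sum_sub_distrib, Finset.mul_sum, Finset.sum_mul]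
      congr 1
      · congr 1
        · exact Finset.sum_congr rfl fun j _ => by ring
        · exact Finset.sum_congr rfl fun j _ => by ring
      · ring
    simp only [this, Finset.sum_sub_distrib, ← Finset.mul_sum]
    ring
  have t2 : ∑ i ∈ A, c i - a2 * ∑ j, y j = ∑ j, y j * d j - a1 * A.card := by
    have : ∀ j, y j * d j = ∑ i ∈ A, y j * (e i j - Real.exp 2 * p) - a2 * y j := by
      intro j; simp only [hd, mul_sub, Finset.mul_sum, Finset.sum_sub_distrib]; ring
    rw [Finset.sum_congr rfl (fun j _ => this j), hc, Finset.sum_sub_distrib, Finset.sum_sub_distrib,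
      ← Finset.mul_sum, Finset.sum_const, nsmul_eq_mul, Finset.sum_comm]
    ring
  have t3 : ∑ j ∈ B, d j = ∑ i ∈ A, ∑ j ∈ B, e i j - Real.exp 2 * p * A.card * B.card - a2 * B.card := by
    simp only [hd, Finset.sum_sub_distrib]
    rw [Finset.sum_comm]
    simp; ring
  linarith
end PartD2


section PartU1

section
attribute [local instance] Matrix.frobeniusNormedAddCommGroup

theorem pu_norm {a b : ℕ} (A : Matrix (Fin a) (Fin b) ℝ) : frob A = ‖A‖ := by
  rw [frobenius_norm_def, frob, Real.sqrt_eq_rpow]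
  congr 1
  refine Finset.sum_congr rfl fun i _ => Finset.sum_congr rfl fun j _ => ?_
  rw [Real.norm_eq_abs]
  norm_num

theorem pu_add {a b : ℕ} (A B : Matrix (Fin a) (Fin b) ℝ) : frob (A + B) ≤ frob A + frob B := by
  simp only [pu_norm]; exact norm_add_le A B

theorem pu_sub {a b : ℕ} (A B : Matrix (Fin a) (Fin b) ℝ) : frob (A - B) ≤ frob A + frob B := by
  simp only [pu_norm]; exact norm_sub_le A B

theorem pu_sub_comm {a b : ℕ} (A B : Matrix (Fin a) (Fin b) ℝ) : frob (A - B) = frob (B - A) := by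
  simp only [pu_norm]; exact norm_sub_rev A B

theorem pu_neg {a b : ℕ} (A : Matrix (Fin a) (Fin b) ℝ) : frob (-A) = frob A := by
  simp only [pu_norm]; exact norm_neg A

theorem pu_tr {a b : ℕ} (A : Matrix (Fin a) (Fin b) ℝ) : frob (Aᵀ) = frob A := by
  rw [frob, frob, Finset.sum_comm]; rfl

theorem pu_mul {a b c : ℕ} (A : Matrix (Fin a) (Fin b) ℝ) (B : Matrix (Fin b) (Fin c) ℝ) :
    frob (A * B) ≤ frob A * frob B := by
  simp only [pu_norm]; exact frobenius_norm_mul A B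

theorem pu_eq_zero {a b : ℕ} (A : Matrix (Fin a) (Fin b) ℝ) (h : frob A = 0) : A = 0 := by
  rw [pu_norm] at h; exact norm_eq_zero.1 h
end

theorem pu_nonneg {a b : ℕ} (A : Matrix (Fin a) (Fin b) ℝ) : 0 ≤ frob A := Real.sqrt_nonneg _

theorem pu_sq {a b : ℕ} (A : Matrix (Fin a) (Fin b) ℝ) : frob A ^ 2 = ∑ i, ∑ j, A i j ^ 2 :=
  Real.sq_sqrt (Finset.sum_nonneg fun _ _ => Finset.sum_nonneg fun _ _ => sq_nonneg _)

theorem pu_inner {a b : ℕ} (A B : Matrix (Fin a) (Fin b) ℝ) : finner A B = (Aᵀ * B).trace := by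
  rw [finner, trace, Finset.sum_comm]
  simp [mul_apply]

theorem pu_sq' {a b : ℕ} (A : Matrix (Fin a) (Fin b) ℝ) : frob A ^ 2 = (Aᵀ * A).trace := by
  rw [← pu_inner, pu_sq, finner]
  simp only [sq]

theorem pu_inner_self {a b : ℕ} (A : Matrix (Fin a) (Fin b) ℝ) : finner A A = frob A ^ 2 := by
  rw [pu_sq', pu_inner]

theorem pu_smul {a b : ℕ} (c : ℝ) (A : Matrix (Fin a) (Fin b) ℝ) : frob (c • A) = |c| * frob A := by
  rw [frob, frob, ← Real.sqrt_sq_eq_abs, ← Real.sqrt_mul (sq_nonneg c), Finset.mul_sum]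
  simp only [Finset.mul_sum, Matrix.smul_apply, smul_eq_mul, mul_pow]

theorem pu_cs {a b : ℕ} (A B : Matrix (Fin a) (Fin b) ℝ) : |finner A B| ≤ frob A * frob B := by
  refine abs_le_of_sq_le_sq ?_ (mul_nonneg (pu_nonneg _) (pu_nonneg _))
  rw [mul_pow, pu_sq, pu_sq, finner, ← Fintype.sum_prod_type', ← Fintype.sum_prod_type', ← Fintype.sum_prod_type']
  exact Finset.sum_mul_sq_le_sq_mul_sq _ _ _

theorem pu_trace_le {a b : ℕ} (A : Matrix (Fin a) (Fin b) ℝ) (B : Matrix (Fin b) (Fin a) ℝ) :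
    |(A * B).trace| ≤ frob A * frob B := by
  have := pu_cs Aᵀ B
  rwa [pu_inner, transpose_transpose, pu_tr] at this

theorem pu_one (r : ℕ) : frob (1 : Matrix (Fin r) (Fin r) ℝ) = Real.sqrt r := by
  have := pu_sq' (1 : Matrix (Fin r) (Fin r) ℝ)
  rw [transpose_one, Matrix.one_mul, trace_one, Fintype.card_fin] at this
  rw [← this, Real.sqrt_sq (pu_nonneg _)]

theorem pu_iso {a r k : ℕ} (Q : Matrix (Fin a) (Fin r) ℝ) (hQ : Qᵀ * Q = 1) (A : Matrix (Fin r) (Fin k) ℝ) :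
    frob (Q * A) = frob A := by
  have : frob (Q * A) ^ 2 = frob A ^ 2 := by
    rw [pu_sq', pu_sq', transpose_mul, Matrix.mul_assoc, ← Matrix.mul_assoc Qᵀ, hQ, Matrix.one_mul]
  exact (sq_eq_sq₀ (pu_nonneg _) (pu_nonneg _)).1 this

/-- Pythagoras -/
theorem pu_pyth {a r k : ℕ} (Q : Matrix (Fin a) (Fin r) ℝ) (hQ : Qᵀ * Q = 1) (A : Matrix (Fin a) (Fin k) ℝ) :
    frob A ^ 2 = frob (Qᵀ * A) ^ 2 + frob (A - Q * (Qᵀ * A)) ^ 2 := by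
  rw [← pu_iso Q hQ (Qᵀ * A)]
  set B := Q * (Qᵀ * A) with hB
  have h0 : Bᵀ * (A - B) = 0 := by
    rw [hB, transpose_mul, Matrix.mul_sub, Matrix.mul_assoc, Matrix.mul_assoc, ← Matrix.mul_assoc Qᵀ Q, hQ, Matrix.one_mul, sub_self]
  have h1 : (A - B)ᵀ * B = 0 := by
    have := congrArg transpose h0
    rwa [transpose_mul, transpose_transpose, transpose_zero] at this
  have hA : A = B + (A - B) := by abel
  have e : Aᵀ * A = Bᵀ * B + (A - B)ᵀ * (A - B) := by
    conv_lhs => rw [hA]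
    rw [transpose_add, Matrix.add_mul, Matrix.mul_add, Matrix.mul_add, h0, h1]; abel
  rw [pu_sq', pu_sq', pu_sq', e, trace_add]

theorem pu_contr {a r k : ℕ} (Q : Matrix (Fin a) (Fin r) ℝ) (hQ : Qᵀ * Q = 1) (A : Matrix (Fin a) (Fin k) ℝ) :
    frob (Qᵀ * A) ≤ frob A := by
  have := pu_pyth Q hQ A
  exact (sq_le_sq₀ (pu_nonneg _) (pu_nonneg _)).1 (by nlinarith [sq_nonneg (frob (A - Q * (Qᵀ * A)))])

theorem pu_contr2 {a r k : ℕ} (Q : Matrix (Fin a) (Fin r) ℝ) (hQ : Qᵀ * Q = 1) (A : Matrix (Fin a) (Fin k) ℝ) :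
    frob (A - Q * (Qᵀ * A)) ≤ frob A := by
  have := pu_pyth Q hQ A
  exact (sq_le_sq₀ (pu_nonneg _) (pu_nonneg _)).1 (by nlinarith [sq_nonneg (frob (Qᵀ * A))])

theorem pu_contr' {a r k : ℕ} (Q : Matrix (Fin a) (Fin r) ℝ) (hQ : Qᵀ * Q = 1) (A : Matrix (Fin k) (Fin a) ℝ) :
    frob (A * Q) ≤ frob A := by
  have := pu_contr Q hQ Aᵀ
  rwa [← transpose_mul, pu_tr, pu_tr] at this

theorem pu_diag_le {r k : ℕ} (σ : Fin r → ℝ) (s : ℝ) (h0 : ∀ i, 0 ≤ σ i) (h1 : ∀ i, σ i ≤ s) (hs : 0 ≤ s)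
    (A : Matrix (Fin r) (Fin k) ℝ) : frob (diagonal σ * A) ≤ s * frob A := by
  refine (sq_le_sq₀ (pu_nonneg _) (mul_nonneg hs (pu_nonneg _))).1 ?_
  rw [mul_pow, pu_sq, pu_sq, Finset.mul_sum]
  refine Finset.sum_le_sum fun i _ => ?_
  rw [Finset.mul_sum]
  refine Finset.sum_le_sum fun j _ => ?_
  rw [diagonal_mul, mul_pow]
  exact mul_le_mul_of_nonneg_right (pow_le_pow_left₀ (h0 i) (h1 i) 2) (sq_nonneg _)

theorem pu_diag_ge {r k : ℕ} (σ : Fin r → ℝ) (s : ℝ) (h1 : ∀ i, s ≤ σ i) (hs : 0 ≤ s)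
    (A : Matrix (Fin r) (Fin k) ℝ) : s * frob A ≤ frob (diagonal σ * A) := by
  refine (sq_le_sq₀ (mul_nonneg hs (pu_nonneg _)) (pu_nonneg _)).1 ?_
  rw [mul_pow, pu_sq, pu_sq, Finset.mul_sum]
  refine Finset.sum_le_sum fun i _ => ?_
  rw [Finset.mul_sum]
  refine Finset.sum_le_sum fun j _ => ?_
  rw [diagonal_mul, mul_pow]
  exact mul_le_mul_of_nonneg_right (pow_le_pow_left₀ hs (h1 i) 2) (sq_nonneg _)

theorem pu_isUnit {r : ℕ} (T : Matrix (Fin r) (Fin r) ℝ) (c : ℝ) (hc : 0 < c)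
    (h : ∀ A : Matrix (Fin r) (Fin r) ℝ, c * frob A ≤ frob (T * A)) : IsUnit T.det := by
  rw [isUnit_iff_ne_zero]
  intro hdet
  obtain ⟨v, hv, hTv⟩ := exists_mulVec_eq_zero_iff.2 hdet
  have h1 := h (vecMulVec v v)
  have h2 : T * vecMulVec v v = 0 := by rw [mul_vecMulVec, hTv, zero_vecMulVec]
  have h3 : frob (0 : Matrix (Fin r) (Fin r) ℝ) = 0 := by simp [frob]
  rw [h2, h3] at h1
  have h4 : frob (vecMulVec v v) = 0 := le_antisymm (by nlinarith) (pu_nonneg _)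
  have h5 := pu_eq_zero _ h4
  apply hv
  ext i
  have := congrFun (congrFun h5 i) i
  simpa [vecMulVec_apply] using this

theorem pu_inv {r : ℕ} (σ : Fin r → ℝ) (s d : ℝ) (h1 : ∀ i, s ≤ σ i) (hs : 0 < s)
    (T : Matrix (Fin r) (Fin r) ℝ) (hT : frob (T - diagonal σ) ≤ d) (hd : d ≤ s / 2) :
    ∃ Ti : Matrix (Fin r) (Fin r) ℝ, T * Ti = 1 ∧ Ti * T = 1 ∧
      (∀ (k : ℕ) (Z : Matrix (Fin r) (Fin k) ℝ), frob (Ti * Z) ≤ 2 / s * frob Z) ∧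
      (∀ (k : ℕ) (Z : Matrix (Fin k) (Fin r) ℝ), frob (Z * Ti) ≤ 2 / s * frob Z) := by
  have key : ∀ (T' : Matrix (Fin r) (Fin r) ℝ), frob (T' - diagonal σ) ≤ d →
      ∀ (k : ℕ) (Z : Matrix (Fin r) (Fin k) ℝ), s / 2 * frob Z ≤ frob (T' * Z) := by
    intro T' hT' k Z
    have e : diagonal σ * Z = T' * Z - (T' - diagonal σ) * Z := by rw [Matrix.sub_mul]; abel
    have a1 := pu_diag_ge σ s h1 hs.le Z
    rw [e] at a1
    have a2 := pu_sub (T' * Z) ((T' - diagonal σ) * Z)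
    have a3 := pu_mul (T' - diagonal σ) Z
    have a4 := mul_le_mul_of_nonneg_right (hT'.trans hd) (pu_nonneg Z)
    linarith
  have hTt : frob (Tᵀ - diagonal σ) ≤ d := by
    have : Tᵀ - diagonal σ = (T - diagonal σ)ᵀ := by rw [transpose_sub, diagonal_transpose]
    rw [this, pu_tr]; exact hT
  have hu := pu_isUnit T (s/2) (by positivity) (key T hT r)
  refine ⟨T⁻¹, mul_nonsing_inv T hu, nonsing_inv_mul T hu, ?_, ?_⟩
  · intro k Z
    have := key T hT k (T⁻¹ * Z)
    rw [← Matrix.mul_assoc, mul_nonsing_inv T hu, Matrix.one_mul] at this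
    rw [div_mul_eq_mul_div, le_div_iff₀ hs]; linarith
  · intro k Z
    have := key Tᵀ hTt k (Z * T⁻¹)ᵀ
    rw [← transpose_mul, pu_tr, pu_tr, Matrix.mul_assoc, nonsing_inv_mul T hu, Matrix.mul_one] at this
    rw [div_mul_eq_mul_div, le_div_iff₀ hs]; linarith
end PartU1


section PartU2

set_option maxHeartbeats 1000000 in
theorem pu_core {r : ℕ} (hr : 1 ≤ r) (σ : Fin r → ℝ) (Smax : ℝ) (hσ0 : ∀ k, 0 ≤ σ k) (hσ1 : ∀ k, σ k ≤ Smax)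
    (hS : 0 < Smax) (X1 Y1 W : Matrix (Fin r) (Fin r) ℝ) (βT d w : ℝ) (hβ0 : 0 ≤ βT)
    (hX : frob X1 ≤ βT) (hY : frob Y1 ≤ βT) (hT : frob (X1 * Y1ᵀ - diagonal σ) ≤ d)
    (hw0 : 0 ≤ w) (hw : w * Real.sqrt r ≤ 1 / 1000) (hd : d ≤ Smax / 1000) (hW : frob W ≤ w)
    (hy : 6 * r * Smax ≤ frob Y1 ^ 2) :
    ∃ A Ai : Matrix (Fin r) (Fin r) ℝ, A * Ai = 1 ∧
      (6 * r * Smax ≤ frob X1 ^ 2 → finner X1 (X1 * A) ≤ frob X1 ^ 2) ∧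
      (Ai * Y1ᵀ * (1 + W) * Y1).trace ≤ frob Y1 ^ 2 ∧
      frob (X1 - X1 * A) ≤ w * βT ∧
      frob (Y1ᵀ - Ai * Y1ᵀ * (1 + W)) ≤ 20 * Real.sqrt r * w * βT := by
  have hr0 : (1:ℝ) ≤ r := by exact_mod_cast hr
  set q := Real.sqrt r with hq
  have hq2 : q ^ 2 = r := Real.sq_sqrt (by linarith)
  have hq1 : 1 ≤ q := by rw [hq]; exact Real.one_le_sqrt.2 hr0
  have hw1 : w ≤ 1 / 1000 := le_trans (le_mul_of_one_le_right hw0 hq1) hw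
  set G := Y1ᵀ * Y1 with hG
  set g := frob G with hg
  set y := frob Y1 ^ 2 with hyd
  have hyG : y = G.trace := pu_sq' Y1
  have hypos : 0 < y := by
    have : 0 < 6 * (r:ℝ) * Smax := by positivity
    linarith
  have hyq : y ≤ q * g := by
    have := pu_trace_le (1 : Matrix (Fin r) (Fin r) ℝ) G
    rw [Matrix.one_mul, pu_one, ← hyG] at this
    exact (le_abs_self y).trans this
  have hg0 : 0 < g := by
    have := pu_nonneg G
    by_contra hc
    have : g = 0 := le_antisymm (not_lt.1 hc) this
    rw [this] at hyq; linarith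
  have hgS : 6 * q * Smax ≤ g := by
    have : 6 * q * Smax * q ≤ g * q := by rw [← hq2] at hy; linarith
    exact le_of_mul_le_mul_right this (by linarith)
  set τ := 4 * w * y / g ^ 2 with hτ
  have hτ0 : 0 ≤ τ := by positivity
  have hτg2 : τ * g ^ 2 = 4 * w * y := by rw [hτ]; field_simp
  have hτg : τ * g ≤ 4 * w * q := by
    have := mul_le_mul_of_nonneg_left hyq (by positivity : 0 ≤ 4 * w)
    have : τ * g * g ≤ 4 * w * q * g := by linarith
    exact le_of_mul_le_mul_right this hg0
  have hτS : τ * Smax ≤ 2 / 3 * w := by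
    have h1 : τ * g * (6 * q * Smax) ≤ τ * g * g := mul_le_mul_of_nonneg_left hgS (by positivity)
    have := mul_le_mul_of_nonneg_left hyq (by positivity : 0 ≤ 4 * w)
    have h2 : τ * Smax * (6 * q * g) ≤ 2 / 3 * w * (6 * q * g) := by linarith
    exact le_of_mul_le_mul_right h2 (by positivity)
  set B := τ • G - (2 / 5 * τ * Smax) • (1 : Matrix (Fin r) (Fin r) ℝ) with hB
  set b := 11 / 10 * (τ * g) with hb
  have hb0 : 0 ≤ b := by positivity
  have hbB : frob B ≤ b := by
    have h1 := pu_sub (τ • G) ((2 / 5 * τ * Smax) • (1 : Matrix (Fin r) (Fin r) ℝ))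
    rw [pu_smul, pu_smul, pu_one, abs_of_nonneg hτ0, abs_of_nonneg (by positivity)] at h1
    have h2 : τ * (6 * q * Smax) ≤ τ * g := mul_le_mul_of_nonneg_left hgS hτ0
    have h3 : 2 / 5 * τ * Smax * q = 2 / 5 * (τ * (q * Smax)) := by ring
    rw [h3] at h1
    have : 0 ≤ τ * g := by positivity
    rw [hb]; linarith
  have hbw : b ≤ 22 / 5 * w * q := by rw [hb]; linarith
  have hbs : b ≤ 1 / 100 := by linarith
  have hu : IsUnit (1 + B).det := by
    refine pu_isUnit _ (1 / 2) (by norm_num) fun Z => ?_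
    have e : Z = (1 + B) * Z - B * Z := by rw [Matrix.add_mul, Matrix.one_mul]; abel
    have h1 := pu_sub ((1 + B) * Z) (B * Z)
    rw [← e] at h1
    have h2 := pu_mul B Z
    have h3 := pu_nonneg Z
    have h4 := mul_le_mul_of_nonneg_right (hbB.trans hbs) h3
    linarith
  set Ai := (1 + B)⁻¹ with hAi
  have hAAi : (1 + B) * Ai = 1 := mul_nonsing_inv _ hu
  set R := 1 - Ai with hR
  have hAiR : Ai = 1 - R := by rw [hR]; abel
  have hRB : R = B - B * R := by
    have : (1 + B) * (1 - R) = 1 := by rw [← hAiR]; exact hAAi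
    rw [Matrix.add_mul, Matrix.one_mul, Matrix.mul_sub, Matrix.mul_one] at this
    have h2 : R = (1 - R + (B - B * R)) - 1 + R + R - (B - B * R) + (B - B * R) - R := by
      rw [this]; abel
    have h3 : 1 - R + (B - B * R) - 1 = 0 := by rw [this, sub_self]
    have h4 : B - B * R - R = 0 := by rw [← h3]; abel
    exact (sub_eq_zero.1 h4).symm
  have hRb : frob R ≤ 2 * b := by
    have h1 := pu_sub B (B * R)
    rw [← hRB] at h1
    have h2 := pu_mul B R
    have h3 := pu_nonneg R
    have h4 := mul_le_mul_of_nonneg_right (hbB.trans hbs) h3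
    linarith
  have hR0 := pu_nonneg R
  have hY0 := pu_nonneg Y1
  have hX0 := pu_nonneg X1
  refine ⟨1 + B, Ai, hAAi, ?_, ?_, ?_, ?_⟩
  · intro hx
    have e : finner X1 (X1 * (1 + B)) = frob X1 ^ 2 + (τ * frob (X1 * Y1ᵀ) ^ 2 - 2 / 5 * τ * Smax * frob X1 ^ 2) := by
      rw [pu_inner, Matrix.mul_add, Matrix.mul_one, Matrix.mul_add, trace_add, ← pu_sq', hB, Matrix.mul_sub,
        Matrix.mul_smul, Matrix.mul_smul, Matrix.mul_one, Matrix.mul_sub, trace_sub, Matrix.mul_smul, Matrix.mul_smul, trace_smul, trace_smul,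
        ← pu_sq', smul_eq_mul, smul_eq_mul]
      congr 3
      rw [pu_sq', transpose_mul, transpose_transpose, hG, Matrix.mul_assoc Y1, trace_mul_comm Y1]
      simp only [Matrix.mul_assoc]
    rw [e]
    have hTn : frob (X1 * Y1ᵀ) ≤ 11 / 10 * (Smax * q) := by
      have h1 := pu_add (X1 * Y1ᵀ - diagonal σ) (diagonal σ)
      rw [sub_add_cancel] at h1
      have h2 := pu_diag_le σ Smax hσ0 hσ1 hS.le (1 : Matrix (Fin r) (Fin r) ℝ)
      rw [Matrix.mul_one, pu_one] at h2
      have h3 := le_mul_of_one_le_right hS.le hq1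
      linarith
    have hT2 : frob (X1 * Y1ᵀ) ^ 2 ≤ 2 * r * Smax ^ 2 := by
      have := pow_le_pow_left₀ (pu_nonneg _) hTn 2
      rw [← hq2]
      linarith [sq_nonneg (Smax * q)]
    have h3 : τ * frob (X1 * Y1ᵀ) ^ 2 ≤ τ * (2 * r * Smax ^ 2) := mul_le_mul_of_nonneg_left hT2 hτ0
    have h4 : 2 / 5 * τ * Smax * (6 * r * Smax) ≤ 2 / 5 * τ * Smax * frob X1 ^ 2 :=
      mul_le_mul_of_nonneg_left hx (by positivity)
    have h5 : 0 ≤ τ * (r * Smax ^ 2) := by positivity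
    linarith
  · have e : (Ai * Y1ᵀ * (1 + W) * Y1).trace = y + (W * (Y1 * Y1ᵀ)).trace - (R * G).trace - (R * (Y1ᵀ * W * Y1)).trace := by
      have e1 : Ai * Y1ᵀ * (1 + W) * Y1 = G + Y1ᵀ * (W * Y1) - R * G - R * (Y1ᵀ * W * Y1) := by
        rw [hAiR, hG]; noncomm_ring
      rw [e1, trace_sub, trace_sub, trace_add, ← hyG, trace_mul_comm Y1ᵀ, Matrix.mul_assoc]
    rw [e]
    have t1 := (le_abs_self _).trans (pu_trace_le W (Y1 * Y1ᵀ))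
    have t2 := (neg_le_abs _).trans (pu_trace_le R (Y1ᵀ * W * Y1))
    have n1 : frob (Y1 * Y1ᵀ) ≤ y := by
      have := pu_mul Y1 Y1ᵀ
      rw [pu_tr] at this; rw [hyd, sq]; exact this
    have n2 : frob (Y1ᵀ * W * Y1) ≤ w * y := by
      have h1 := pu_mul (Y1ᵀ * W) Y1
      have h2 := pu_mul Y1ᵀ W
      rw [pu_tr] at h2
      have h3 : frob (Y1ᵀ * W) ≤ frob Y1 * w := h2.trans (mul_le_mul_of_nonneg_left hW hY0)
      have h4 := mul_le_mul_of_nonneg_right h3 hY0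
      rw [hyd]; linarith
    have t1' : (W * (Y1 * Y1ᵀ)).trace ≤ w * y :=
      t1.trans (mul_le_mul hW n1 (pu_nonneg _) hw0)
    have t2' : -(R * (Y1ᵀ * W * Y1)).trace ≤ 2 * b * (w * y) :=
      t2.trans (mul_le_mul hRb n2 (pu_nonneg _) (by positivity))
    have hBG : 3 * w * y ≤ (B * G).trace := by
      have e2 : (B * G).trace = τ * g ^ 2 - 2 / 5 * τ * Smax * y := by
        rw [hB, Matrix.sub_mul, Matrix.smul_mul, Matrix.smul_mul, Matrix.one_mul, trace_sub, trace_smul, trace_smul,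
          ← hyG, hg, pu_sq', smul_eq_mul, smul_eq_mul]
        congr 3
        rw [hG, transpose_mul, transpose_transpose]
      rw [e2, hτg2]
      have : τ * Smax * y ≤ 2 / 3 * w * y := mul_le_mul_of_nonneg_right hτS hypos.le
      have : 0 ≤ w * y := by positivity
      linarith
    have hBRG : (B * R * G).trace ≤ b * (2 * b) * g := by
      have h1 := (le_abs_self _).trans (pu_trace_le (B * R) G)
      have h2 := (pu_mul B R).trans (mul_le_mul hbB hRb hR0 hb0)
      exact h1.trans (mul_le_mul_of_nonneg_right h2 hg0.le)
    have hRG : (R * G).trace = (B * G).trace - (B * R * G).trace := by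
      conv_lhs => rw [hRB, Matrix.sub_mul, trace_sub]
    have hbg : b * g = 22 / 5 * (w * y) := by rw [hb]; linarith
    have hwy : 0 ≤ w * y := by positivity
    have h6 : b * (2 * b) * g = 44 / 5 * (b * (w * y)) := by
      have : b * (2 * b) * g = 2 * b * (b * g) := by ring
      rw [this, hbg]; ring
    have h7 : b * (w * y) ≤ 1 / 100 * (w * y) := mul_le_mul_of_nonneg_right hbs hwy
    rw [hRG]
    linarith
  · have e : X1 - X1 * (1 + B) = (2 / 5 * τ * Smax) • X1 - τ • (X1 * Y1ᵀ * Y1) := by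
      rw [hB, hG, Matrix.mul_add, Matrix.mul_one, Matrix.mul_sub, Matrix.mul_smul, Matrix.mul_smul, Matrix.mul_one, Matrix.mul_assoc]
      abel
    rw [e]
    have h1 := pu_sub ((2 / 5 * τ * Smax) • X1) (τ • (X1 * Y1ᵀ * Y1))
    rw [pu_smul, pu_smul, abs_of_nonneg hτ0, abs_of_nonneg (by positivity)] at h1
    have h2 : frob (X1 * Y1ᵀ * Y1) ≤ 11 / 10 * Smax * βT := by
      have e2 : X1 * Y1ᵀ * Y1 = (X1 * Y1ᵀ - diagonal σ) * Y1 + diagonal σ * Y1 := by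
        rw [Matrix.sub_mul]; abel
      have a1 := pu_add ((X1 * Y1ᵀ - diagonal σ) * Y1) (diagonal σ * Y1)
      rw [← e2] at a1
      have a2 := pu_mul (X1 * Y1ᵀ - diagonal σ) Y1
      have a3 := pu_diag_le σ Smax hσ0 hσ1 hS.le Y1
      have a4 := mul_le_mul (hT.trans hd) hY hY0 (by positivity)
      have a5 := mul_le_mul_of_nonneg_left hY hS.le
      have a6 : 0 ≤ Smax * βT := by positivity
      linarith
    have h3 := mul_le_mul_of_nonneg_left h2 hτ0
    have h4 : 2 / 5 * τ * Smax * frob X1 ≤ 2 / 5 * τ * Smax * βT := mul_le_mul_of_nonneg_left hX (by positivity)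
    have h5 : τ * Smax * βT ≤ 2 / 3 * w * βT := mul_le_mul_of_nonneg_right hτS hβ0
    have : 0 ≤ w * βT := by positivity
    linarith
  · have e : Y1ᵀ - Ai * Y1ᵀ * (1 + W) = R * (Y1ᵀ * (1 + W)) - Y1ᵀ * W := by
      rw [hAiR]; noncomm_ring
    rw [e]
    have h1 := pu_sub (R * (Y1ᵀ * (1 + W))) (Y1ᵀ * W)
    have h2 := pu_mul R (Y1ᵀ * (1 + W))
    have h3 := pu_mul Y1ᵀ W
    have h4 : frob (Y1ᵀ * (1 + W)) ≤ frob Y1 + frob (Y1ᵀ * W) := by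
      rw [Matrix.mul_add, Matrix.mul_one]
      have := pu_add Y1ᵀ (Y1ᵀ * W)
      rwa [pu_tr] at this
    rw [pu_tr] at h3
    have h5 : frob (Y1ᵀ * W) ≤ βT * w := h3.trans (mul_le_mul hY hW (pu_nonneg _) hβ0)
    have h6 : frob (Y1ᵀ * (1 + W)) ≤ 11 / 10 * βT := by
      have := mul_le_mul_of_nonneg_left hw1 hβ0
      linarith
    have h7 : frob (R * (Y1ᵀ * (1 + W))) ≤ 2 * b * (11 / 10 * βT) :=
      h2.trans (mul_le_mul hRb h6 (pu_nonneg _) (by positivity))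
    have h8 : b * βT ≤ 22 / 5 * w * q * βT := mul_le_mul_of_nonneg_right hbw hβ0
    have h9 : w * βT ≤ q * w * βT := by
      have : 0 ≤ w * βT := by positivity
      have := le_mul_of_one_le_right this hq1
      linarith
    have h10 : 0 ≤ w * βT := by positivity
    linarith
end PartU2


section PartU3

theorem pu_innersub {m r : ℕ} (Q : Matrix (Fin m) (Fin r) ℝ) (hQ : Qᵀ * Q = 1) (X : Matrix (Fin m) (Fin r) ℝ)
    (A : Matrix (Fin r) (Fin r) ℝ) (h : finner (Qᵀ * X) A ≤ frob (Qᵀ * X) ^ 2) :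
    0 ≤ finner X (X - Q * A) := by
  have e : finner X (X - Q * A) = frob X ^ 2 - finner (Qᵀ * X) A := by
    rw [pu_inner, Matrix.mul_sub, trace_sub, ← pu_sq', pu_inner, transpose_mul, transpose_transpose, Matrix.mul_assoc]
  have := pu_contr Q hQ X
  have h2 := pow_le_pow_left₀ (pu_nonneg _) this 2
  rw [e]; linarith

theorem pu_big {m r : ℕ} (Q : Matrix (Fin m) (Fin r) ℝ) (hQ : Qᵀ * Q = 1) (X : Matrix (Fin m) (Fin r) ℝ)
    (βT w z : ℝ) (hβ : βT ^ 2 = 10 * z) (hβ0 : 0 ≤ βT) (hw0 : 0 ≤ w) (hw1 : w ≤ 1 / 1000)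
    (h2 : frob (X - Q * (Qᵀ * X)) ≤ w * βT) (h : 2 / 3 * βT ^ 2 < frob X ^ 2) :
    6 * z ≤ frob (Qᵀ * X) ^ 2 := by
  have h3 := pu_pyth Q hQ X
  have h4 := pow_le_pow_left₀ (pu_nonneg _) h2 2
  have h5 : w ^ 2 ≤ (1 / 1000) ^ 2 := pow_le_pow_left₀ hw0 hw1 2
  have h6 : w ^ 2 * βT ^ 2 ≤ (1 / 1000) ^ 2 * βT ^ 2 := mul_le_mul_of_nonneg_right h5 (sq_nonneg _)
  rw [mul_pow] at h4
  have h7 := sq_nonneg βT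
  linarith

set_option maxHeartbeats 1000000 in
theorem pu_main {m n r : ℕ} (hr : 1 ≤ r) (M : Matrix (Fin m) (Fin n) ℝ)
    (Uh : Matrix (Fin m) (Fin r) ℝ) (Vh : Matrix (Fin n) (Fin r) ℝ) (σ : Fin r → ℝ) (Smax Smin : ℝ)
    (hU : Uhᵀ * Uh = 1) (hV : Vhᵀ * Vh = 1) (hM : M = Uh * diagonal σ * Vhᵀ)
    (hσ1 : ∀ k, σ k ≤ Smax) (hσ2 : ∀ k, Smin ≤ σ k) (hS : 0 < Smin) (hSS : Smin ≤ Smax)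
    (X : Matrix (Fin m) (Fin r) ℝ) (Y : Matrix (Fin n) (Fin r) ℝ) (βT w : ℝ) (hβ0 : 0 ≤ βT)
    (hβ : βT ^ 2 = 10 * (r * Smax)) (hX : frob X ≤ βT) (hY : frob Y ≤ βT)
    (hwd : w = 2 / Smin * frob (M - X * Yᵀ)) (hw : w * Real.sqrt r ≤ 1 / 1000) :
    ∃ UA VA : Matrix (Fin r) (Fin r) ℝ, (Uh * UA) * (Vh * VA)ᵀ = M ∧
      frob UA ≤ 11 / 10 * βT ∧ frob VA ≤ 11 / 10 * βT ∧
      frob (X - Uh * UA) ≤ 3 * w * βT ∧ frob (Y - Vh * VA) ≤ 22 * Real.sqrt r * w * βT ∧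
      (2 / 3 * βT ^ 2 < frob X ^ 2 → 0 ≤ finner X (X - Uh * UA)) ∧
      (2 / 3 * βT ^ 2 < frob Y ^ 2 → 0 ≤ finner Y (Y - Vh * VA)) := by
  have hr0 : (1:ℝ) ≤ r := by exact_mod_cast hr
  set q := Real.sqrt r with hq
  have hq1 : 1 ≤ q := by rw [hq]; exact Real.one_le_sqrt.2 hr0
  set E := M - X * Yᵀ with hE
  set d := frob E with hd
  have hd0 : 0 ≤ d := pu_nonneg _
  have hw0 : 0 ≤ w := by rw [hwd]; positivity
  have hw1 : w ≤ 1 / 1000 := le_trans (le_mul_of_one_le_right hw0 hq1) hw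
  have hdw : d = Smin / 2 * w := by rw [hwd]; field_simp
  have hdS : d ≤ Smin / 2000 := by
    rw [hdw]
    have := mul_le_mul_of_nonneg_left hw1 hS.le
    linarith
  set X1 := Uhᵀ * X with hX1
  set Y1 := Vhᵀ * Y with hY1
  have hX1b : frob X1 ≤ βT := (pu_contr Uh hU X).trans hX
  have hY1b : frob Y1 ≤ βT := (pu_contr Vh hV Y).trans hY
  have hMV : M * Vh = Uh * diagonal σ := by rw [hM, Matrix.mul_assoc, hV, Matrix.mul_one]
  have hUM : Uhᵀ * M = diagonal σ * Vhᵀ := by rw [hM, ← Matrix.mul_assoc, ← Matrix.mul_assoc, hU, Matrix.one_mul]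
  have hXY : X * Yᵀ = M - E := by rw [hE]; abel
  have hXY1 : X * Y1ᵀ = M * Vh - E * Vh := by
    rw [hY1, transpose_mul, transpose_transpose, ← Matrix.mul_assoc, hXY, Matrix.sub_mul]
  have hXY2 : X1 * Yᵀ = Uhᵀ * M - Uhᵀ * E := by
    rw [hX1, Matrix.mul_assoc, hXY, Matrix.mul_sub]
  have hTe : X1 * Y1ᵀ - diagonal σ = -(Uhᵀ * (E * Vh)) := by
    rw [hX1, Matrix.mul_assoc, hXY1, hMV, Matrix.mul_sub, ← Matrix.mul_assoc, hU, Matrix.one_mul]; abel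
  have hTn : frob (X1 * Y1ᵀ - diagonal σ) ≤ d := by
    rw [hTe, pu_neg]
    exact (pu_contr Uh hU _).trans (pu_contr' Vh hV E)
  obtain ⟨Ti, hTTi, hTiT, hTi1, hTi2⟩ := pu_inv σ Smin d hσ2 hS (X1 * Y1ᵀ) hTn (by linarith)
  set X2 := X - Uh * X1 with hX2
  set Y2 := Y - Vh * Y1 with hY2
  have hYTX : Y1ᵀ * Ti * X1 = 1 := by
    rw [Matrix.mul_assoc] at hTTi
    exact mul_eq_one_comm.1 hTTi
  have hwd' : 2 / Smin * d = w := hwd.symm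
  have hX2b : frob X2 ≤ w * βT := by
    have e1 : X2 = (X2 * Y1ᵀ) * Ti * X1 := by
      have : (X2 * Y1ᵀ) * Ti * X1 = X2 * (Y1ᵀ * Ti * X1) := by simp only [Matrix.mul_assoc]
      rw [this, hYTX, Matrix.mul_one]
    have e2 : X2 * Y1ᵀ = -(E * Vh - Uh * (Uhᵀ * (E * Vh))) := by
      rw [hX2, Matrix.sub_mul, Matrix.mul_assoc, hX1, Matrix.mul_assoc, hXY1, hMV, Matrix.mul_sub, ← Matrix.mul_assoc Uhᵀ Uh, hU,
        Matrix.one_mul, Matrix.mul_sub]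
      abel
    have h1 : frob (X2 * Y1ᵀ) ≤ d := by
      rw [e2, pu_neg]; exact (pu_contr2 Uh hU _).trans (pu_contr' Vh hV E)
    have h2 := hTi2 m (X2 * Y1ᵀ)
    have h3 : frob (X2 * Y1ᵀ * Ti) ≤ w := by
      rw [← hwd']; exact h2.trans (mul_le_mul_of_nonneg_left h1 (by positivity))
    rw [e1]
    exact (pu_mul _ _).trans (mul_le_mul h3 hX1b (pu_nonneg _) hw0)
  have hY2b : frob Y2 ≤ w * βT := by
    have e1 : Y2ᵀ = Y1ᵀ * (Ti * (X1 * Y2ᵀ)) := by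
      have : Y1ᵀ * (Ti * (X1 * Y2ᵀ)) = (Y1ᵀ * Ti * X1) * Y2ᵀ := by simp only [Matrix.mul_assoc]
      rw [this, hYTX, Matrix.one_mul]
    have e2 : X1 * Y2ᵀ = -(Uhᵀ * E - (Uhᵀ * E) * Vh * Vhᵀ) := by
      rw [hY2, transpose_sub, Matrix.mul_sub, transpose_mul, hY1, transpose_mul, transpose_transpose, ← Matrix.mul_assoc, ← Matrix.mul_assoc, hXY2, hUM,
        Matrix.sub_mul, Matrix.sub_mul, Matrix.mul_assoc _ Vhᵀ Vh, hV, Matrix.mul_one]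
      abel
    have h1 : frob (X1 * Y2ᵀ) ≤ d := by
      rw [e2, pu_neg, ← pu_tr]
      have : (Uhᵀ * E - Uhᵀ * E * Vh * Vhᵀ)ᵀ = (Uhᵀ * E)ᵀ - Vh * (Vhᵀ * (Uhᵀ * E)ᵀ) := by
        rw [transpose_sub, transpose_mul (Uhᵀ * E * Vh), transpose_mul (Uhᵀ * E) Vh, transpose_transpose]
      rw [this]
      refine (pu_contr2 Vh hV _).trans ?_
      rw [pu_tr]; exact pu_contr Uh hU E
    have h2 := hTi1 n (X1 * Y2ᵀ)
    have h3 : frob (Ti * (X1 * Y2ᵀ)) ≤ w := by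
      rw [← hwd']; exact h2.trans (mul_le_mul_of_nonneg_left h1 (by positivity))
    rw [← pu_tr, e1]
    refine (pu_mul _ _).trans ?_
    rw [pu_tr, mul_comm]
    exact mul_le_mul h3 hY1b (pu_nonneg _) hw0
  set W := Ti * diagonal σ - 1 with hW
  have hWb : frob W ≤ w := by
    have e : W = Ti * (-(X1 * Y1ᵀ - diagonal σ)) := by
      rw [hW, Matrix.mul_neg, Matrix.mul_sub, hTiT]; abel
    rw [e, ← hwd']
    refine (hTi1 r _).trans (mul_le_mul_of_nonneg_left ?_ (by positivity))
    rw [pu_neg]; exact hTn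
  have hS0 : 0 < Smax := by linarith
  have hwβ : 0 ≤ w * βT := by positivity
  have hqwβ := le_mul_of_one_le_right hwβ hq1
  have core : ∃ A Ai : Matrix (Fin r) (Fin r) ℝ, A * Ai = 1 ∧
      (2 / 3 * βT ^ 2 < frob X ^ 2 → finner X1 (X1 * A) ≤ frob X1 ^ 2) ∧
      (2 / 3 * βT ^ 2 < frob Y ^ 2 → (Ai * Y1ᵀ * (1 + W) * Y1).trace ≤ frob Y1 ^ 2) ∧
      frob (X1 - X1 * A) ≤ w * βT ∧
      frob (Y1ᵀ - Ai * Y1ᵀ * (1 + W)) ≤ 20 * q * w * βT := by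
    by_cases hbig : 2 / 3 * βT ^ 2 < frob Y ^ 2
    · have hy := pu_big Vh hV Y βT w (r * Smax) hβ hβ0 hw0 hw1 hY2b hbig
      obtain ⟨A, Ai, h1, h2, h3, h4, h5⟩ := pu_core hr σ Smax (fun k => hS.le.trans (hσ2 k)) hσ1 hS0 X1 Y1 W βT d w hβ0
        hX1b hY1b hTn hw0 hw (by linarith) hWb (by linarith)
      refine ⟨A, Ai, h1, fun hx => h2 ?_, fun _ => h3, h4, h5⟩
      have := pu_big Uh hU X βT w (r * Smax) hβ hβ0 hw0 hw1 hX2b hx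
      linarith
    · refine ⟨1, 1, Matrix.one_mul 1, fun _ => ?_, fun h => absurd h hbig, ?_, ?_⟩
      · rw [Matrix.mul_one, pu_inner_self]
      · rw [Matrix.mul_one, sub_self]
        have : frob (0 : Matrix (Fin r) (Fin r) ℝ) = 0 := by simp [frob]
        rw [this]; exact hwβ
      · have e : Y1ᵀ - 1 * Y1ᵀ * (1 + W) = -(Y1ᵀ * W) := by
          rw [Matrix.one_mul, Matrix.mul_add, Matrix.mul_one]; abel
        rw [e, pu_neg]
        have h1 := pu_mul Y1ᵀ W
        rw [pu_tr] at h1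
        have h2 := mul_le_mul hY1b hWb (pu_nonneg _) hβ0
        linarith
  obtain ⟨A, Ai, hAAi, hx, hy, hxn, hyn⟩ := core
  have eX : X - Uh * (X1 * A) = X2 + Uh * (X1 - X1 * A) := by rw [hX2, Matrix.mul_sub]; abel
  set V1 := (Ai * Y1ᵀ * (1 + W))ᵀ with hV1
  have hV1n : frob (Y1 - V1) ≤ 20 * q * w * βT := by
    rw [← pu_tr, hV1, transpose_sub, transpose_transpose]; exact hyn
  have eY : Y - Vh * V1 = Y2 + Vh * (Y1 - V1) := by rw [hY2, Matrix.mul_sub]; abel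
  have hqw : q * w * βT ≤ 1 / 1000 * βT := by
    have := mul_le_mul_of_nonneg_right hw hβ0
    linarith
  refine ⟨X1 * A, V1, ?_, ?_, ?_, ?_, ?_, ?_, ?_⟩
  · have h1W : 1 + W = Ti * diagonal σ := by rw [hW]; abel
    rw [transpose_mul, hV1, transpose_transpose, h1W, hM]
    have : Uh * (X1 * A) * (Ai * Y1ᵀ * (Ti * diagonal σ) * Vhᵀ) =
        Uh * (X1 * (A * Ai) * Y1ᵀ * Ti * diagonal σ) * Vhᵀ := by simp only [Matrix.mul_assoc]
    rw [this, hAAi, Matrix.mul_one, hTTi, Matrix.one_mul]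
  · have h1 := pu_sub X1 (X1 - X1 * A)
    rw [sub_sub_cancel] at h1
    linarith
  · have h1 := pu_sub Y1 (Y1 - V1)
    rw [sub_sub_cancel] at h1
    linarith
  · rw [eX]
    have h1 := pu_add X2 (Uh * (X1 - X1 * A))
    rw [pu_iso Uh hU] at h1
    linarith
  · rw [eY]
    have h1 := pu_add Y2 (Vh * (Y1 - V1))
    rw [pu_iso Vh hV] at h1
    linarith
  · intro h
    exact pu_innersub Uh hU X (X1 * A) (hx h)
  · intro h
    refine pu_innersub Vh hV Y V1 ?_
    have e : finner (Vhᵀ * Y) V1 = (Ai * Y1ᵀ * (1 + W) * Y1).trace := by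
      rw [pu_inner, ← trace_transpose, transpose_mul, transpose_transpose, transpose_transpose]
    rw [e]; exact hy h
end PartU3


section PartF1

theorem pf_add {a b : ℕ} (A B C : Matrix (Fin a) (Fin b) ℝ) : finner (A + B) C = finner A C + finner B C := by
  simp only [finner, Matrix.add_apply, add_mul, Finset.sum_add_distrib]

theorem pf_smul {a b : ℕ} (c : ℝ) (A C : Matrix (Fin a) (Fin b) ℝ) : finner (c • A) C = c * finner A C := by
  simp only [finner, Matrix.smul_apply, smul_eq_mul, Finset.mul_sum, mul_assoc]

theorem pf_sum {a b : ℕ} {ι : Type} (s : Finset ι) (f : ι → Matrix (Fin a) (Fin b) ℝ) (C : Matrix (Fin a) (Fin b) ℝ) :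
    finner (∑ i ∈ s, f i) C = ∑ i ∈ s, finner (f i) C := by
  induction s using Finset.induction_on with
  | empty => simp [finner]
  | insert i s hi ih => rw [Finset.sum_insert hi, Finset.sum_insert hi, pf_add, ih]

theorem pf_rowMat {a b : ℕ} (A C : Matrix (Fin a) (Fin b) ℝ) (i : Fin a) :
    finner (rowMat A i) C = ∑ j, A i j * C i j := by
  rw [finner, Finset.sum_eq_single i]
  · simp [rowMat]
  · intro i' _ h
    simp [rowMat, h]
  · simp

theorem pf_rowsq {a b : ℕ} (A : Matrix (Fin a) (Fin b) ℝ) (i : Fin a) : rowNorm A i ^ 2 = ∑ j, A i j ^ 2 :=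
  Real.sq_sqrt (Finset.sum_nonneg fun _ _ => sq_nonneg _)

theorem pf_coef (ρ q β t : ℝ) (hρ : 0 ≤ ρ) (hβ : 0 < β) (h : 2 / 3 * β ^ 2 < q → 0 ≤ t) :
    0 ≤ ρ * G0' (3 * q / (2 * β ^ 2)) * (3 / β ^ 2) * t := by
  by_cases hz : 2 / 3 * β ^ 2 < q
  · have := h hz
    unfold G0'
    have : 0 ≤ max 0 (3 * q / (2 * β ^ 2) - 1) := le_max_left _ _
    positivity
  · have : G0' (3 * q / (2 * β ^ 2)) = 0 := by
      unfold G0'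
      rw [max_eq_left]
      · ring
      · rw [sub_nonpos, div_le_one (by positivity)]
        linarith
    rw [this]; simp

theorem pf_reg {m r : ℕ} (ρ β βT : ℝ) (hρ : 0 ≤ ρ) (hβ : 0 < β) (hβT : 0 < βT) (X U : Matrix (Fin m) (Fin r) ℝ)
    (hrow : ∀ i, ∑ j, U i j ^ 2 ≤ 2 / 3 * β ^ 2) (hF : 2 / 3 * βT ^ 2 < frob X ^ 2 → 0 ≤ finner X (X - U)) :
    0 ≤ finner (gradG1 ρ β βT X) (X - U) := by
  rw [gradG1, pf_add, pf_sum, pf_smul]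
  refine add_nonneg (Finset.sum_nonneg fun i _ => ?_) (pf_coef _ _ _ _ hρ hβT hF)
  rw [pf_smul, pf_rowMat]
  refine pf_coef _ _ _ _ hρ hβ fun h => ?_
  rw [pf_rowsq] at h
  have cs := Finset.sum_mul_sq_le_sq_mul_sq Finset.univ (fun j => X i j) (fun j => U i j)
  have h0 : 0 ≤ ∑ j, X i j ^ 2 := Finset.sum_nonneg fun _ _ => sq_nonneg _
  have h1 : ∑ j, U i j ^ 2 ≤ ∑ j, X i j ^ 2 := (hrow i).trans h.le
  have h2 : ∑ j, X i j * U i j ≤ ∑ j, X i j ^ 2 := by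
    refine abs_le_of_sq_le_sq' ?_ h0 |>.2
    have := mul_le_mul_of_nonneg_left h1 h0
    rw [sq (∑ j, X i j ^ 2)]
    linarith
  have h3 : ∑ j, X i j * (X - U) i j = ∑ j, X i j ^ 2 - ∑ j, X i j * U i j := by
    rw [← Finset.sum_sub_distrib]
    refine Finset.sum_congr rfl fun j _ => ?_
    rw [Matrix.sub_apply]; ring
  rw [h3]; linarith

theorem pf_row {m r k : ℕ} (Q : Matrix (Fin m) (Fin r) ℝ) (A : Matrix (Fin r) (Fin k) ℝ) (i : Fin m) :
    ∑ j, (Q * A) i j ^ 2 ≤ (∑ l, Q i l ^ 2) * frob A ^ 2 := by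
  rw [pu_sq, Finset.sum_comm, Finset.mul_sum]
  refine Finset.sum_le_sum fun j _ => ?_
  rw [mul_apply]
  exact Finset.sum_mul_sq_le_sq_mul_sq _ _ _

theorem pf_rowsub {m r : ℕ} (X U : Matrix (Fin m) (Fin r) ℝ) (i : Fin m) (q : ℝ)
    (h1 : ∑ j, X i j ^ 2 ≤ q) (h2 : ∑ j, U i j ^ 2 ≤ q) : ∑ j, (X - U) i j ^ 2 ≤ 4 * q := by
  have : ∑ j, (X - U) i j ^ 2 ≤ ∑ j, (2 * X i j ^ 2 + 2 * U i j ^ 2) := by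
    refine Finset.sum_le_sum fun j _ => ?_
    rw [Matrix.sub_apply]
    nlinarith [sq_nonneg (X i j + U i j)]
  rw [Finset.sum_add_distrib, ← Finset.mul_sum, ← Finset.mul_sum] at this
  linarith

theorem pf_b {m n r : ℕ} (p a1 a2 β1 β2 : ℝ) (ha1 : 0 ≤ a1) (ha2 : 0 ≤ a2) (hβ1 : 0 < β1) (hβ2 : 0 < β2)
    (Ω : Finset (Fin m × Fin n)) (hgood : ¬ pdBad p a1 a2 Ω)
    (E : Matrix (Fin m) (Fin r) ℝ) (F : Matrix (Fin n) (Fin r) ℝ)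
    (hE : ∀ i, ∑ j, E i j ^ 2 ≤ 4 * β1 ^ 2) (hF : ∀ i, ∑ j, F i j ^ 2 ≤ 4 * β2 ^ 2) :
    ∑ k ∈ Ω, (E * Fᵀ) k.1 k.2 ^ 2 ≤ Real.exp 2 * p * (frob E ^ 2 * frob F ^ 2) +
      4 * β2 ^ 2 * a1 * frob E ^ 2 + 4 * β1 ^ 2 * a2 * frob F ^ 2 := by
  have h1 : (0:ℝ) < 4 * β1 ^ 2 := by positivity
  have h2 : (0:ℝ) < 4 * β2 ^ 2 := by positivity
  have hd := pd_det p a1 a2 ha1 ha2 Ω hgood (fun i => (∑ j, E i j ^ 2) / (4 * β1 ^ 2))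
    (fun i => (∑ j, F i j ^ 2) / (4 * β2 ^ 2))
    (fun i => div_nonneg (Finset.sum_nonneg fun _ _ => sq_nonneg _) h1.le) (fun i => (div_le_one h1).2 (hE i))
    (fun i => div_nonneg (Finset.sum_nonneg fun _ _ => sq_nonneg _) h2.le) (fun i => (div_le_one h2).2 (hF i))
  simp only [← Finset.sum_div] at hd
  rw [← pu_sq, ← pu_sq] at hd
  have hs : ∑ k ∈ Ω, (E * Fᵀ) k.1 k.2 ^ 2 ≤
      (4 * β1 ^ 2) * (4 * β2 ^ 2) * ∑ k ∈ Ω, (∑ j, E k.1 j ^ 2) / (4 * β1 ^ 2) * ((∑ j, F k.2 j ^ 2) / (4 * β2 ^ 2)) := by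
    rw [Finset.mul_sum]
    refine Finset.sum_le_sum fun k _ => ?_
    have e : (4 * β1 ^ 2) * (4 * β2 ^ 2) * ((∑ j, E k.1 j ^ 2) / (4 * β1 ^ 2) * ((∑ j, F k.2 j ^ 2) / (4 * β2 ^ 2))) =
      (∑ j, E k.1 j ^ 2) * (∑ j, F k.2 j ^ 2) := by field_simp
    rw [e, mul_apply]
    exact Finset.sum_mul_sq_le_sq_mul_sq _ _ _
  have h3 := mul_le_mul_of_nonneg_left hd (mul_pos h1 h2).le
  refine hs.trans (h3.trans (le_of_eq ?_))
  field_simp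

theorem pf_main1 {m n r : ℕ} (Ω : Finset (Fin m × Fin n)) (M : Matrix (Fin m) (Fin n) ℝ)
    (X U : Matrix (Fin m) (Fin r) ℝ) (Y V : Matrix (Fin n) (Fin r) ℝ) (hUV : U * Vᵀ = M) :
    finner (projOmega Ω (X * Yᵀ - M) * Y) (X - U) + finner ((projOmega Ω (X * Yᵀ - M))ᵀ * X) (Y - V) =
      ∑ k ∈ Ω, ((U * (Y - V)ᵀ + (X - U) * Vᵀ) k.1 k.2 + ((X - U) * (Y - V)ᵀ) k.1 k.2) *
        ((U * (Y - V)ᵀ + (X - U) * Vᵀ) k.1 k.2 + 2 * ((X - U) * (Y - V)ᵀ) k.1 k.2) := by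
  have e1 : X * Yᵀ - M = U * (Y - V)ᵀ + (X - U) * Vᵀ + (X - U) * (Y - V)ᵀ := by
    rw [← hUV]
    simp only [transpose_sub, Matrix.mul_sub, Matrix.sub_mul]; abel
  have e2 : (X - U) * Yᵀ + X * (Y - V)ᵀ =
      U * (Y - V)ᵀ + (X - U) * Vᵀ + ((X - U) * (Y - V)ᵀ + (X - U) * (Y - V)ᵀ) := by
    simp only [transpose_sub, Matrix.mul_sub, Matrix.sub_mul]; abel
  have e3 : finner (projOmega Ω (X * Yᵀ - M) * Y) (X - U) + finner ((projOmega Ω (X * Yᵀ - M))ᵀ * X) (Y - V) =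
      finner (projOmega Ω (X * Yᵀ - M)) ((X - U) * Yᵀ + X * (Y - V)ᵀ) := by
    simp only [pu_inner, Matrix.mul_add, trace_add, transpose_mul, transpose_transpose]
    congr 1
    · rw [Matrix.mul_assoc, trace_mul_comm, Matrix.mul_assoc]
    · rw [← trace_transpose, transpose_mul, transpose_mul, transpose_transpose, trace_mul_comm, Matrix.mul_assoc]
  rw [e3, e2, e1]
  set a := U * (Y - V)ᵀ + (X - U) * Vᵀ
  set b := (X - U) * (Y - V)ᵀ
  rw [finner, ← Fintype.sum_prod_type']
  rw [← Finset.sum_subset (Finset.subset_univ Ω)]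
  · refine Finset.sum_congr rfl fun k hk => ?_
    simp only [projOmega, Matrix.of_apply, Matrix.add_apply]
    rw [if_pos hk]; ring
  · intro k _ hk
    simp only [projOmega, Matrix.of_apply]
    rw [if_neg hk]; ring

theorem pf_core {m n r : ℕ} (Ω : Finset (Fin m × Fin n)) (M : Matrix (Fin m) (Fin n) ℝ)
    (Uh : Matrix (Fin m) (Fin r) ℝ) (Vh : Matrix (Fin n) (Fin r) ℝ) (UA VA : Matrix (Fin r) (Fin r) ℝ)
    (X : Matrix (Fin m) (Fin r) ℝ) (Y : Matrix (Fin n) (Fin r) ℝ) (p d : ℝ) (hp : 0 ≤ p)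
    (hUV : (Uh * UA) * (Vh * VA)ᵀ = M) (hpt : ¬ ptBad Uh Vh (3 / 10 * p) Ω) (hd : d = frob (M - X * Yᵀ))
    (hxy : frob (X - Uh * UA) * frob (Y - Vh * VA) ≤ 1 / 1000 * d)
    (hB : ∑ k ∈ Ω, ((X - Uh * UA) * (Y - Vh * VA)ᵀ) k.1 k.2 ^ 2 ≤ 1 / 10000 * (p * d ^ 2)) :
    p / 4 * d ^ 2 ≤ finner (projOmega Ω (X * Yᵀ - M) * Y) (X - Uh * UA) +
      finner ((projOmega Ω (X * Yᵀ - M))ᵀ * X) (Y - Vh * VA) := by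
  rw [pf_main1 Ω M X (Uh * UA) Y (Vh * VA) hUV]
  set b := (X - Uh * UA) * (Y - Vh * VA)ᵀ with hb
  set a := Uh * UA * (Y - Vh * VA)ᵀ + (X - Uh * UA) * (Vh * VA)ᵀ with ha
  have hd0 : 0 ≤ d := by rw [hd]; exact pu_nonneg _
  have hbn : frob b ≤ 1 / 1000 * d := by
    have := pu_mul (X - Uh * UA) (Y - Vh * VA)ᵀ
    rw [pu_tr] at this
    exact this.trans hxy
  have hab : d ≤ frob a + frob b := by
    have e : X * Yᵀ - M = a + b := by
      rw [ha, hb, ← hUV]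
      simp only [transpose_sub, Matrix.mul_sub, Matrix.sub_mul]; abel
    rw [hd, pu_sub_comm, e]
    exact pu_add a b
  have han : 999 / 1000 * d ≤ frob a := by linarith
  have ha2 : 998 / 1000 * d ^ 2 ≤ frob a ^ 2 := by
    have := pow_le_pow_left₀ (by positivity) han 2
    nlinarith [sq_nonneg d]
  have hpa : 3 / 10 * p * frob a ^ 2 ≤ ∑ k ∈ Ω, a k.1 k.2 ^ 2 := by
    by_contra hc
    apply hpt
    refine ⟨(UA * (Y - Vh * VA)ᵀ)ᵀ, (X - Uh * UA) * VAᵀ, ?_⟩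
    have e : Uh * (UA * (Y - Vh * VA)ᵀ)ᵀᵀ + (X - Uh * UA) * VAᵀ * Vhᵀ = a := by
      rw [ha, transpose_transpose, transpose_mul Vh VA, Matrix.mul_assoc, Matrix.mul_assoc]
    rw [e, ← pu_sq]
    exact not_le.1 hc
  have hsum : 95 / 100 * ∑ k ∈ Ω, a k.1 k.2 ^ 2 - 43 * ∑ k ∈ Ω, b k.1 k.2 ^ 2 ≤
      ∑ k ∈ Ω, (a k.1 k.2 + b k.1 k.2) * (a k.1 k.2 + 2 * b k.1 k.2) := by
    rw [Finset.mul_sum, Finset.mul_sum, ← Finset.sum_sub_distrib]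
    refine Finset.sum_le_sum fun k _ => ?_
    nlinarith [sq_nonneg (a k.1 k.2 + 30 * b k.1 k.2), sq_nonneg (b k.1 k.2)]
  have h5 := mul_le_mul_of_nonneg_left ha2 hp
  have h6 : 0 ≤ p * d ^ 2 := by positivity
  linarith

set_option maxHeartbeats 1000000 in
theorem pf_det {m n r : ℕ} (μ : ℝ) (M : Matrix (Fin m) (Fin n) ℝ)
    (Uh : Matrix (Fin m) (Fin r) ℝ) (Vh : Matrix (Fin n) (Fin r) ℝ)
    (σ : Fin r → ℝ) (Smax Smin : ℝ) (hn : 1 ≤ n) (hnm : n ≤ m) (hr : 1 ≤ r) (hμ : 1 ≤ μ)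
    (hU : Uhᵀ * Uh = 1) (hV : Vhᵀ * Vh = 1) (hM : M = Uh * diagonal σ * Vhᵀ)
    (hσ1 : ∀ k, σ k ≤ Smax) (hσ2 : ∀ k, Smin ≤ σ k) (hS : 0 < Smin) (hSS : Smin ≤ Smax)
    (hiU : ∀ i, ∑ k, Uh i k ^ 2 ≤ μ * r / m) (hiV : ∀ j, ∑ k, Vh j k ^ 2 ≤ μ * r / n)
    (p h h' κ δ ρ βT β1 β2 : ℝ) (hp : 0 < p) (hρ : 0 ≤ ρ) (hκ : κ = Smax / Smin)
    (hδ : δ = Smin / (100000000 * (r : ℝ) ^ ((3 : ℝ) / 2) * κ))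
    (hβT : βT = Real.sqrt (10 * r * Smax)) (hβ1 : β1 = βT * Real.sqrt (3 * μ * r / m))
    (hβ2 : β2 = βT * Real.sqrt (3 * μ * r / n))
    (hh : h = 1000000000000 * (μ * r ^ 3 * κ ^ 2)) (hh' : h' = 1000000000000 * (μ * r ^ 4 * κ ^ 2))
    (Ω : Finset (Fin m × Fin n)) (hpt : ¬ ptBad Uh Vh (3 / 10 * p) Ω)
    (hpd : ¬ pdBad p (p * n / h) (p * m / h') Ω)
    (X : Matrix (Fin m) (Fin r) ℝ) (Y : Matrix (Fin n) (Fin r) ℝ)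
    (hK1 : K1mem β1 β2 X Y) (hK2 : K2mem βT X Y) (hK : Kmem M δ X Y) :
    ∃ (U : Matrix (Fin m) (Fin r) ℝ) (V : Matrix (Fin n) (Fin r) ℝ),
      U * Vᵀ = M ∧ p / 4 * frob (M - X * Yᵀ) ^ 2 ≤
        finner (gradX Ω M ρ β1 βT X Y) (X - U) + finner (gradY Ω M ρ β2 βT X Y) (Y - V) := by
  have hn0 : (0:ℝ) < n := by exact_mod_cast hn
  have hm0 : (0:ℝ) < m := by exact_mod_cast (hn.trans hnm)
  have hr1 : (1:ℝ) ≤ r := by exact_mod_cast hr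
  have hr0 : (0:ℝ) < r := by linarith
  have hμ0 : 0 < μ := by linarith
  have hSm : 0 < Smax := hS.trans_le hSS
  have hκ1 : 1 ≤ κ := by rw [hκ, le_div_iff₀ hS]; linarith
  have hκ0 : 0 < κ := by linarith
  set d := frob (M - X * Yᵀ) with hd
  have hd0 : 0 ≤ d := pu_nonneg _
  have hdδ : d ≤ δ := hK
  set q := Real.sqrt r with hq
  have hq2 : q ^ 2 = r := Real.sq_sqrt hr0.le
  have hq1 : 1 ≤ q := by rw [hq]; exact Real.one_le_sqrt.2 hr1
  have hr32 : (r : ℝ) ^ ((3 : ℝ) / 2) = r * q := by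
    rw [show (3:ℝ) / 2 = 1 + 1 / 2 by norm_num, Real.rpow_add hr0, Real.rpow_one, hq, Real.sqrt_eq_rpow]
  rw [hr32] at hδ
  have hβTpos : 0 < βT := by rw [hβT]; positivity
  have hβTsq : βT ^ 2 = 10 * (r * Smax) := by rw [hβT, Real.sq_sqrt (by positivity)]; ring
  have hβ1pos : 0 < β1 := by rw [hβ1]; positivity
  have hβ2pos : 0 < β2 := by rw [hβ2]; positivity
  have hβ1sq : β1 ^ 2 = βT ^ 2 * (3 * μ * r / m) := by rw [hβ1, mul_pow, Real.sq_sqrt (by positivity)]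
  have hβ2sq : β2 ^ 2 = βT ^ 2 * (3 * μ * r / n) := by rw [hβ2, mul_pow, Real.sq_sqrt (by positivity)]
  have hhp : 0 < h := by rw [hh]; positivity
  have hhp' : 0 < h' := by rw [hh']; positivity
  -- d * (1e8 r q κ) ≤ Smin
  have hdS : d * (100000000 * (r * q) * κ) ≤ Smin := by
    rw [hδ, le_div_iff₀ (by positivity)] at hdδ
    exact hdδ
  have hSk : Smax = κ * Smin := by rw [hκ]; field_simp
  set w := 2 / Smin * d with hw
  have hw0 : 0 ≤ w := by positivity
  have hwS : w * Smin = 2 * d := by rw [hw]; field_simp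
  have hwq : w * q ≤ 1 / 1000 := by
    have h1 : w * q = 2 * (d * q) / Smin := by rw [hw]; ring
    rw [h1, div_le_iff₀ hS]
    have h2 : d * q ≤ d * q * (r * κ) := le_mul_of_one_le_right (by positivity) (one_le_mul_of_one_le_of_one_le hr1 hκ1)
    linarith
  obtain ⟨UA, VA, hUV, hUA, hVA, hXU, hYV, hXi, hYi⟩ := pu_main hr M Uh Vh σ Smax Smin hU hV hM hσ1 hσ2 hS hSS X Y
    βT w hβTpos.le hβTsq hK2.1 hK2.2 hw hwq
  have rowU : ∀ i, ∑ j, (Uh * UA) i j ^ 2 ≤ 2 / 3 * β1 ^ 2 := by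
    intro i
    refine (pf_row Uh UA i).trans ?_
    have h1 := pow_le_pow_left₀ (pu_nonneg _) hUA 2
    have h2 := mul_le_mul (hiU i) h1 (sq_nonneg _) (by positivity)
    refine h2.trans ?_
    rw [hβ1sq]
    have : 0 ≤ μ * r / m * βT ^ 2 := by positivity
    calc μ * r / m * (11 / 10 * βT) ^ 2 = 121 / 100 * (μ * r / m * βT ^ 2) := by ring
      _ ≤ 2 * (μ * r / m * βT ^ 2) := by linarith
      _ = _ := by ring
  have rowV : ∀ i, ∑ j, (Vh * VA) i j ^ 2 ≤ 2 / 3 * β2 ^ 2 := by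
    intro i
    refine (pf_row Vh VA i).trans ?_
    have h1 := pow_le_pow_left₀ (pu_nonneg _) hVA 2
    have h2 := mul_le_mul (hiV i) h1 (sq_nonneg _) (by positivity)
    refine h2.trans ?_
    rw [hβ2sq]
    have : 0 ≤ μ * r / n * βT ^ 2 := by positivity
    calc μ * r / n * (11 / 10 * βT) ^ 2 = 121 / 100 * (μ * r / n * βT ^ 2) := by ring
      _ ≤ 2 * (μ * r / n * βT ^ 2) := by linarith
      _ = _ := by ring
  have rowE : ∀ i, ∑ j, (X - Uh * UA) i j ^ 2 ≤ 4 * β1 ^ 2 := fun i => by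
    refine pf_rowsub _ _ i _ ?_ ?_
    · rw [← pf_rowsq]; exact pow_le_pow_left₀ (Real.sqrt_nonneg _) (hK1.1 i) 2
    · have := rowU i; have := sq_nonneg β1; linarith
  have rowF : ∀ i, ∑ j, (Y - Vh * VA) i j ^ 2 ≤ 4 * β2 ^ 2 := fun i => by
    refine pf_rowsub _ _ i _ ?_ ?_
    · rw [← pf_rowsq]; exact pow_le_pow_left₀ (Real.sqrt_nonneg _) (hK1.2 i) 2
    · have := rowV i; have := sq_nonneg β2; linarith
  refine ⟨Uh * UA, Vh * VA, hUV, ?_⟩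
  rw [gradX, gradY, pf_add, pf_add]
  have hregX := pf_reg ρ β1 βT hρ hβ1pos hβTpos X (Uh * UA) rowU hXi
  have hregY := pf_reg ρ β2 βT hρ hβ2pos hβTpos Y (Vh * VA) rowV hYi
  set x := frob (X - Uh * UA) with hx
  set y := frob (Y - Vh * VA) with hy
  have hx0 : 0 ≤ x := pu_nonneg _
  have hy0 : 0 ≤ y := pu_nonneg _
  have hxy : x * y ≤ 1 / 1000 * d := by
    have h1 := mul_le_mul hXU hYV hy0 (by positivity)
    have h2 : 3 * w * βT * (22 * q * w * βT) = 66 * q * w ^ 2 * βT ^ 2 := by ring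
    rw [h2, hβTsq, hSk] at h1
    have h3 : 66 * q * w ^ 2 * (10 * (r * (κ * Smin))) = 660 * (r * q * κ) * (w * (w * Smin)) := by ring
    rw [h3, hwS] at h1
    -- w * 1e8 r q κ ≤ 2
    have h4 : w * (100000000 * (r * q) * κ) ≤ 2 := by
      have : w * (100000000 * (r * q) * κ) = 2 * (d * (100000000 * (r * q) * κ)) / Smin := by rw [hw]; ring
      rw [this, div_le_iff₀ hS]; linarith
    have h5 := mul_le_mul_of_nonneg_right h4 hd0
    linarith
  have hx2 : x ^ 2 ≤ 9 * (w ^ 2 * βT ^ 2) := by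
    have := pow_le_pow_left₀ hx0 hXU 2
    linarith
  have hy2 : y ^ 2 ≤ 484 * (r * (w ^ 2 * βT ^ 2)) := by
    have := pow_le_pow_left₀ hy0 hYV 2
    rw [← hq2]
    linarith
  have hwb : w ^ 2 * βT ^ 2 * βT ^ 2 = 400 * (r ^ 2 * κ ^ 2 * d ^ 2) := by
    rw [hβTsq, hSk]
    have : w ^ 2 * (10 * (r * (κ * Smin))) * (10 * (r * (κ * Smin))) = 100 * (r ^ 2 * κ ^ 2 * (w * Smin) ^ 2) := by ring
    rw [this, hwS]; ring
  have hbb := pf_b p (p * n / h) (p * m / h') β1 β2 (by positivity) (by positivity) hβ1pos hβ2pos Ω hpd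
    (X - Uh * UA) (Y - Vh * VA) rowE rowF
  rw [← hx, ← hy] at hbb
  have t1 : Real.exp 2 * p * (x ^ 2 * y ^ 2) ≤ 1 / 20000 * (p * d ^ 2) := by
    have h1 := pow_le_pow_left₀ (by positivity) hxy 2
    have h2 : Real.exp 2 ≤ 8 := by
      have := Real.exp_one_lt_d9
      have e : Real.exp 2 = Real.exp 1 ^ 2 := by rw [← Real.exp_nat_mul]; norm_num
      rw [e]
      have := pow_le_pow_left₀ (Real.exp_pos 1).le this.le 2
      norm_num at this
      linarith
    have h3 := mul_le_mul h2 (mul_le_mul_of_nonneg_left h1 hp.le) (by positivity) (by norm_num)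
    have : 0 ≤ p * d ^ 2 := by positivity
    linarith
  have t2 : 4 * β2 ^ 2 * (p * n / h) * x ^ 2 ≤ 1 / 100000 * (p * d ^ 2) := by
    have h1 := mul_le_mul_of_nonneg_left hx2 (show 0 ≤ 4 * β2 ^ 2 * (p * n / h) by positivity)
    refine h1.trans ?_
    have e : 4 * β2 ^ 2 * (p * n / h) * (9 * (w ^ 2 * βT ^ 2)) =
        108 * (μ * r * p / h) * (w ^ 2 * βT ^ 2 * βT ^ 2) := by
      rw [hβ2sq]; field_simp; ring
    rw [e, hwb, hh]
    have e2 : 108 * (μ * r * p / (1000000000000 * (μ * r ^ 3 * κ ^ 2))) * (400 * (r ^ 2 * κ ^ 2 * d ^ 2)) =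
        43200 / 1000000000000 * (p * d ^ 2) := by field_simp; ring
    rw [e2]
    have : 0 ≤ p * d ^ 2 := by positivity
    linarith
  have t3 : 4 * β1 ^ 2 * (p * m / h') * y ^ 2 ≤ 1 / 100000 * (p * d ^ 2) := by
    have h1 := mul_le_mul_of_nonneg_left hy2 (show 0 ≤ 4 * β1 ^ 2 * (p * m / h') by positivity)
    refine h1.trans ?_
    have e : 4 * β1 ^ 2 * (p * m / h') * (484 * (r * (w ^ 2 * βT ^ 2))) =
        5808 * (μ * r ^ 2 * p / h') * (w ^ 2 * βT ^ 2 * βT ^ 2) := by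
      rw [hβ1sq]; field_simp; ring
    rw [e, hwb, hh']
    have e2 : 5808 * (μ * r ^ 2 * p / (1000000000000 * (μ * r ^ 4 * κ ^ 2))) * (400 * (r ^ 2 * κ ^ 2 * d ^ 2)) =
        2323200 / 1000000000000 * (p * d ^ 2) := by field_simp; ring
    rw [e2]
    have : 0 ≤ p * d ^ 2 := by positivity
    linarith
  have hB : ∑ k ∈ Ω, ((X - Uh * UA) * (Y - Vh * VA)ᵀ) k.1 k.2 ^ 2 ≤ 1 / 10000 * (p * d ^ 2) := by
    have : 0 ≤ p * d ^ 2 := by positivity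
    linarith
  have hcore := pf_core Ω M Uh Vh UA VA X Y p d hp.le hUV hpt hd hxy hB
  linarith
end PartF1


section PartF2

theorem pf_num (m n r S : ℕ) (μ κ : ℝ) (hn : 2 ≤ n) (hnm : n ≤ m) (hr : 1 ≤ r) (hμ : 1 ≤ μ) (hκ : 1 ≤ κ)
    (hS : (10:ℝ) ^ 27 * ((m : ℝ) / n) * n * r * κ ^ 2 *
              max (μ * Real.log n) (Real.sqrt ((m : ℝ) / n) * μ ^ 2 * (r : ℝ) ^ 6 * κ ^ 4) ≤ S)
    (hSN : S ≤ m * n) (p : ℝ) (hp : p = (S:ℝ) / (m * n)) :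
    0 < S ∧ 64 * ((1000000000000 * (μ * r ^ 3 * κ ^ 2)) * (1000000000000 * (μ * r ^ 4 * κ ^ 2))) ≤ p * n ∧
    p * n ≤ p * m ∧
    2 * ((m * n) * Real.exp (-(3 / 400 * p * n / (μ * r)))) ≤ 1 / (2 * (n:ℝ) ^ 4) := by
  have hn2 : (2:ℝ) ≤ n := by exact_mod_cast hn
  have hn0 : (0:ℝ) < n := by linarith
  have hnm' : (n:ℝ) ≤ m := by exact_mod_cast hnm
  have hm0 : (0:ℝ) < m := by linarith
  have hr1 : (1:ℝ) ≤ r := by exact_mod_cast hr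
  have hr0 : (0:ℝ) < r := by linarith
  have hμ0 : 0 < μ := by linarith
  have hκ0 : 0 < κ := by linarith
  have hSN' : (S:ℝ) ≤ m * n := by exact_mod_cast hSN
  have e0 : (10:ℝ) ^ 27 * ((m : ℝ) / n) * n * r * κ ^ 2 = 10 ^ 27 * m * r * κ ^ 2 := by field_simp
  rw [e0] at hS
  set α := Real.sqrt ((m : ℝ) / n) with hα
  have hα1 : 1 ≤ α := by rw [hα, Real.one_le_sqrt, le_div_iff₀ hn0]; linarith
  have hα2 : α ^ 2 * n = m := by rw [hα, Real.sq_sqrt (by positivity)]; field_simp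
  have hlog : 0 ≤ Real.log n := Real.log_nonneg (by linarith)
  have b1 : 10 ^ 27 * m * r * κ ^ 2 * (μ * Real.log n) ≤ S :=
    (mul_le_mul_of_nonneg_left (le_max_left _ _) (by positivity)).trans hS
  have b2 : 10 ^ 27 * m * r * κ ^ 2 * (α * μ ^ 2 * (r : ℝ) ^ 6 * κ ^ 4) ≤ S :=
    (mul_le_mul_of_nonneg_left (le_max_right _ _) (by positivity)).trans hS
  have hκ2 : 1 ≤ κ ^ 2 := one_le_pow₀ hκ
  have hS0 : (0:ℝ) < S := lt_of_lt_of_le (by positivity) b2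
  have hpn : p * n = S / m := by rw [hp]; field_simp
  have hp0 : 0 ≤ p := by rw [hp]; positivity
  refine ⟨by exact_mod_cast hS0, ?_, mul_le_mul_of_nonneg_left hnm' hp0, ?_⟩
  · rw [hpn, le_div_iff₀ hm0]
    refine le_trans ?_ b2
    have h1 : 1 ≤ α * κ ^ 2 := one_le_mul_of_one_le_of_one_le hα1 hκ2
    have h2 : 0 ≤ m * (μ ^ 2 * (r:ℝ) ^ 7 * κ ^ 4) := by positivity
    have h3 := le_mul_of_one_le_right h2 h1
    have h4 : 10 ^ 27 * m * r * κ ^ 2 * (α * μ ^ 2 * (r : ℝ) ^ 6 * κ ^ 4) =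
      10 ^ 27 * (m * (μ ^ 2 * (r:ℝ) ^ 7 * κ ^ 4) * (α * κ ^ 2)) := by ring
    have h5 : 64 * ((1000000000000 * (μ * r ^ 3 * κ ^ 2)) * (1000000000000 * (μ * r ^ 4 * κ ^ 2))) * m =
      64 * 10 ^ 24 * (m * (μ ^ 2 * (r:ℝ) ^ 7 * κ ^ 4)) := by ring
    rw [h4, h5]
    linarith
  · have hαn : α ≤ n := by
      have h1 : m * α ≤ m * n := by
        refine le_trans ?_ (b2.trans hSN')
        have h2 : 10 ^ 27 * m * r * κ ^ 2 * (α * μ ^ 2 * (r : ℝ) ^ 6 * κ ^ 4) =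
          m * α * (10 ^ 27 * (r ^ 7 * κ ^ 6 * μ ^ 2)) := by ring
        rw [h2]
        refine le_mul_of_one_le_right (by positivity) ?_
        have h3 : (1:ℝ) ≤ r ^ 7 * κ ^ 6 * μ ^ 2 :=
          one_le_mul_of_one_le_of_one_le (one_le_mul_of_one_le_of_one_le (one_le_pow₀ hr1) (one_le_pow₀ hκ))
            (one_le_pow₀ hμ)
        linarith
      exact le_of_mul_le_mul_left h1 hm0
    have hm3 : (m:ℝ) * n ≤ n ^ 4 := by
      have h1 := pow_le_pow_left₀ (by linarith) hαn 2
      have h2 := mul_le_mul_of_nonneg_right h1 hn0.le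
      rw [hα2] at h2
      have h3 := mul_le_mul_of_nonneg_right h2 hn0.le
      calc (m:ℝ) * n ≤ n ^ 2 * n * n := h3
        _ = n ^ 4 := by ring
    have hexp : 12 * Real.log n ≤ 3 / 400 * p * n / (μ * r) := by
      rw [le_div_iff₀ (by positivity)]
      have h1 : 10 ^ 27 * r * κ ^ 2 * (μ * Real.log n) ≤ p * n := by
        rw [hpn, le_div_iff₀ hm0]
        linarith
      have h2 : 0 ≤ r * (μ * Real.log n) := by positivity
      have h3 := le_mul_of_one_le_right h2 hκ2
      linarith
    have h1 : Real.exp (-(3 / 400 * p * n / (μ * r))) ≤ 1 / n ^ 12 := by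
      have : Real.exp (-(12 * Real.log n)) = 1 / (n:ℝ) ^ 12 := by
        rw [Real.exp_neg, show (12:ℝ) * Real.log n = ((12:ℕ):ℝ) * Real.log n by norm_num, Real.exp_nat_mul,
          Real.exp_log hn0, one_div]
      rw [← this]
      exact Real.exp_le_exp.2 (by linarith)
    have h2 := mul_le_mul hm3 h1 (Real.exp_pos _).le (by positivity)
    have h3 : (n:ℝ) ^ 4 * (1 / n ^ 12) = 1 / (n ^ 4 * n ^ 4) := by field_simp
    rw [h3] at h2
    have h4 : (4:ℝ) ≤ n ^ 4 := by
      have := pow_le_pow_left₀ (by norm_num) hn2 4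
      linarith
    have h5 : 1 / ((n:ℝ) ^ 4 * n ^ 4) ≤ 1 / (4 * n ^ 4) :=
      one_div_le_one_div_of_le (by positivity) (mul_le_mul_of_nonneg_right h4 (by positivity))
    have h6 : 2 * (1 / (4 * (n:ℝ) ^ 4)) = 1 / (2 * (n:ℝ) ^ 4) := by field_simp; norm_num
    linarith

theorem pf_count {T : Type} (P : Finset T) (good b1 b2 : T → Prop) (hg : ∀ x ∈ P, ¬ b1 x → ¬ b2 x → good x) :
    (P.card : ℝ) - (P.filter b1).card - (P.filter b2).card ≤ (P.filter good).card := by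
  have h : P ⊆ P.filter good ∪ (P.filter b1 ∪ P.filter b2) := by
    intro x hx
    simp only [Finset.mem_union, Finset.mem_filter]
    by_cases h1 : b1 x
    · exact Or.inr (Or.inl ⟨hx, h1⟩)
    · by_cases h2 : b2 x
      · exact Or.inr (Or.inr ⟨hx, h2⟩)
      · exact Or.inl ⟨hx, hg x hx h1 h2⟩
  have h1 := (Finset.card_le_card h).trans ((Finset.card_union_le _ _).trans
    (Nat.add_le_add_left (Finset.card_union_le _ _) _))
  have h2 : (P.card : ℝ) ≤ (P.filter good).card + ((P.filter b1).card + (P.filter b2).card) := by exact_mod_cast h1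
  linarith
end PartF2

/-- **Lemma 1: relative strong convexity near the global optima.**
Probability is expressed by counting: among all subsets `Ω ⊆ [m]×[n]` of cardinality `S`
(the uniform sampling model), the fraction for which the conclusion holds is at least
`1 - 1/n⁴`. -/
theorem stmt0 :
    ∃ C0 Cd CT : ℝ, 0 < C0 ∧ 0 < Cd ∧ 0 < CT ∧
      ∀ (m n r : ℕ) (μ : ℝ) (M : Matrix (Fin m) (Fin n) ℝ)
        (Uh : Matrix (Fin m) (Fin r) ℝ) (Vh : Matrix (Fin n) (Fin r) ℝ)
        (σ : Fin r → ℝ) (Smax Smin : ℝ),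
        1 ≤ n → n ≤ m → 1 ≤ r → 1 ≤ μ →
        Uhᵀ * Uh = 1 → Vhᵀ * Vh = 1 →
        (∀ k, 0 < σ k) → (∀ k l : Fin r, k ≤ l → σ l ≤ σ k) →
        M = Uh * Matrix.diagonal σ * Vhᵀ →
        ((∀ k, σ k ≤ Smax) ∧ ∃ k, σ k = Smax) →
        ((∀ k, Smin ≤ σ k) ∧ ∃ k, σ k = Smin) →
        (∀ i, ∑ k, Uh i k ^ 2 ≤ μ * r / m) →
        (∀ j, ∑ k, Vh j k ^ 2 ≤ μ * r / n) →
        ∀ S : ℕ,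
          C0 * ((m : ℝ) / n) * n * r * (Smax / Smin) ^ 2 *
              max (μ * Real.log n)
                (Real.sqrt ((m : ℝ) / n) * μ ^ 2 * (r : ℝ) ^ 6 * (Smax / Smin) ^ 4) ≤ S →
          let κ : ℝ := Smax / Smin
          let δ : ℝ := Smin / (Cd * (r : ℝ) ^ ((3 : ℝ) / 2) * κ)
          let δ0 : ℝ := δ / 6
          let p : ℝ := (S : ℝ) / (m * n)
          let ρ : ℝ := 8 * p * δ0 ^ 2
          let βT : ℝ := Real.sqrt (CT * r * Smax)
          let β1 : ℝ := βT * Real.sqrt (3 * μ * r / m)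
          let β2 : ℝ := βT * Real.sqrt (3 * μ * r / n)
          (1 - 1 / (n : ℝ) ^ 4) *
              ((Finset.powersetCard S (Finset.univ : Finset (Fin m × Fin n))).card : ℝ) ≤
            (((Finset.powersetCard S (Finset.univ : Finset (Fin m × Fin n))).filter
                (fun Ω =>
                  ∀ (X : Matrix (Fin m) (Fin r) ℝ) (Y : Matrix (Fin n) (Fin r) ℝ),
                    K1mem β1 β2 X Y → K2mem βT X Y → Kmem M δ X Y →
                    ∃ (U : Matrix (Fin m) (Fin r) ℝ) (V : Matrix (Fin n) (Fin r) ℝ),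
                      U * Vᵀ = M ∧
                      p / 4 * frob (M - X * Yᵀ) ^ 2 ≤
                        finner (gradX Ω M ρ β1 βT X Y) (X - U) +
                          finner (gradY Ω M ρ β2 βT X Y) (Y - V))).card : ℝ) := by
  refine ⟨10 ^ 27, 100000000, 10, by norm_num, by norm_num, by norm_num, ?_⟩
  intro m n r μ M Uh Vh σ Smax Smin hn hnm hr hμ hU hV hσ0 hσd hM hmax hmin hiU hiV S hSb κ δ δ0 p ρ βT β1 β2
  obtain ⟨hσ1, k1, hk1⟩ := hmax
  obtain ⟨hσ2, k2, hk2⟩ := hmin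
  have hSmin : 0 < Smin := hk2 ▸ hσ0 k2
  have hSS : Smin ≤ Smax := hk2 ▸ hσ1 k2
  have hκ1 : 1 ≤ κ := (one_le_div hSmin).2 hSS
  by_cases hSN : S ≤ m * n
  swap
  · have : Finset.powersetCard S (Finset.univ : Finset (Fin m × Fin n)) = ∅ := by
      rw [Finset.powersetCard_eq_empty]
      simp only [Finset.card_univ, Fintype.card_prod, Fintype.card_fin]
      omega
    rw [this]; simp
  rcases Nat.lt_or_ge n 2 with hn1 | hn2
  · have : n = 1 := by omega
    subst this
    have h0 : (1 - 1 / ((1:ℕ):ℝ) ^ 4) = 0 := by norm_num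
    rw [h0, zero_mul]
    exact Nat.cast_nonneg _
  obtain ⟨hS0, hb, hpm, he⟩ := pf_num m n r S μ κ hn2 hnm hr hμ hκ1 hSb hSN p rfl
  have hn0 : (0:ℝ) < n := by exact_mod_cast hn
  have hm0 : (0:ℝ) < m := by exact_mod_cast (hn.trans hnm)
  have hS0' : (0:ℝ) < S := by exact_mod_cast hS0
  have hp0 : 0 < p := div_pos hS0' (mul_pos hm0 hn0)
  have hr1 : (1:ℝ) ≤ r := by exact_mod_cast hr
  obtain ⟨h, hh⟩ : ∃ h : ℝ, h = 1000000000000 * (μ * r ^ 3 * κ ^ 2) := ⟨_, rfl⟩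
  obtain ⟨h', hh'⟩ : ∃ h : ℝ, h = 1000000000000 * (μ * r ^ 4 * κ ^ 2) := ⟨_, rfl⟩
  rw [← hh, ← hh'] at hb
  have hh1 : 1 ≤ h := by
    rw [hh]
    have : 1 ≤ μ * r ^ 3 * κ ^ 2 :=
      one_le_mul_of_one_le_of_one_le (one_le_mul_of_one_le_of_one_le hμ (one_le_pow₀ hr1)) (one_le_pow₀ hκ1)
    linarith
  have hh1' : 1 ≤ h' := by
    rw [hh']
    have : 1 ≤ μ * r ^ 4 * κ ^ 2 :=
      one_le_mul_of_one_le_of_one_le (one_le_mul_of_one_le_of_one_le hμ (one_le_pow₀ hr1)) (one_le_pow₀ hκ1)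
    linarith
  have hpd := pd_main hn hnm S hS0 hSN p (p * n / h) (p * m / h') h h' rfl hh1 hh1' rfl rfl
    (by rw [le_div_iff₀ (by linarith)]; linarith) (by rw [le_div_iff₀ (by linarith)]; linarith)
  have hpt := pt_main Uh Vh μ hn hnm hr hμ hU hV hiU hiV S hS0 hSN
  have hcnt := pf_count (Finset.powersetCard S (Finset.univ : Finset (Fin m × Fin n)))
    (fun Ω =>
                  ∀ (X : Matrix (Fin m) (Fin r) ℝ) (Y : Matrix (Fin n) (Fin r) ℝ),
                    K1mem β1 β2 X Y → K2mem βT X Y → Kmem M δ X Y →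
                    ∃ (U : Matrix (Fin m) (Fin r) ℝ) (V : Matrix (Fin n) (Fin r) ℝ),
                      U * Vᵀ = M ∧
                      p / 4 * frob (M - X * Yᵀ) ^ 2 ≤
                        finner (gradX Ω M ρ β1 βT X Y) (X - U) +
                          finner (gradY Ω M ρ β2 βT X Y) (Y - V))
    (ptBad Uh Vh (3 / 10 * p)) (pdBad p (p * n / h) (p * m / h'))
    (fun Ω _ g1 g2 X Y hK1 hK2 hK => pf_det μ M Uh Vh σ Smax Smin hn hnm hr hμ hU hV hM hσ1 hσ2 hSmin hSS hiU hiV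
      p h h' κ δ ρ βT β1 β2 hp0 (mul_nonneg (mul_nonneg (by norm_num) hp0.le) (sq_nonneg _)) rfl rfl rfl rfl rfl
      hh hh' Ω g1 g2 X Y hK1 hK2 hK)
  refine le_trans ?_ hcnt
  have hc0 : (0:ℝ) ≤ (Finset.powersetCard S (Finset.univ : Finset (Fin m × Fin n))).card := Nat.cast_nonneg _
  have h1 := hpt.trans (mul_le_mul_of_nonneg_right he hc0)
  have hq0 : 0 ≤ 1 / (n:ℝ) ^ 4 * (Finset.powersetCard S (Finset.univ : Finset (Fin m × Fin n))).card := by positivity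
  have e1 : 1 / (2 * (n:ℝ) ^ 4) = 1 / 2 * (1 / (n:ℝ) ^ 4) := by field_simp
  have e2 : 1 / (4 * (n:ℝ) ^ 4) = 1 / 4 * (1 / (n:ℝ) ^ 4) := by field_simp
  rw [e1, mul_assoc] at h1
  rw [e2, mul_assoc] at hpd
  rw [sub_mul, one_mul]
  have h1' : (((Finset.powersetCard S (Finset.univ : Finset (Fin m × Fin n))).filter
        (ptBad Uh Vh (3 / 10 * p))).card : ℝ) ≤
      1 / 2 * (1 / (n:ℝ) ^ 4 * (Finset.powersetCard S (Finset.univ : Finset (Fin m × Fin n))).card) := h1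
  linarith

end
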